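/- arXiv:1411.7891 — 5 statements merged into one kernel-verified Lean document; each statement's English description precedes it below -/
import Mathlib

section
/- For every integer n ≥ 2 and every natural number k with k ≠ 1, ω_{n−1} · ∫_{−1}^{1} g_2(t) · P_k^n(t) · (1−t²)^{(n−3)/2} dt = −(π^{(n−2)/2}/4) · Γ(n/2) · Γ((k−1)/2) · Γ((k+1)/2) / (Γ((n+k−1)/2) · Γ((n+k+1)/2)). -/
/-- The Legendre polynomial `P_k^n` of dimension `n` and degree `k`, defined on `(-1,1)`
via Rodrigues' formula. Powers with real exponents are `Real.rpow`, and `(α)_k` is the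
Pochhammer symbol `ascPochhammer`. -/
noncomputable def legendreP (n k : ℕ) (t : ℝ) : ℝ :=
  ((-1 : ℝ) ^ k / (2 ^ k * (ascPochhammer ℝ k).eval (((n : ℝ) - 1) / 2))) *
    (1 - t ^ 2) ^ (-(((n : ℝ) - 3) / 2)) *
    iteratedDeriv k (fun s : ℝ => (1 - s ^ 2) ^ (((n : ℝ) - 3) / 2 + (k : ℝ))) t

/-- C. Berg's function `g₂`. -/
noncomputable def bergG2 (t : ℝ) : ℝ :=
  (1 / (2 * Real.pi)) * ((Real.pi - Real.arccos t) * (1 - t ^ 2) ^ ((1 : ℝ) / 2) - t / 2)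

/-- `ω_m = 2 π^{m/2} / Γ(m/2)`, the surface area of the `m`-dimensional unit ball. -/
noncomputable def omegaBall (m : ℕ) : ℝ :=
  2 * Real.pi ^ ((m : ℝ) / 2) / Real.Gamma ((m : ℝ) / 2)

open Set Filter Topology MeasureTheory

/-- The `j`-th derivative of `s ↦ (1 - s²)^μ`. -/
noncomputable def oneSubSqDeriv (j : ℕ) (μ t : ℝ) : ℝ :=
  iteratedDeriv j (fun s : ℝ => (1 - s ^ 2) ^ μ) t

lemma one_sub_sq_pos {t : ℝ} (ht : t ∈ Ioo (-1 : ℝ) 1) : 0 < 1 - t ^ 2 := by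
  nlinarith [ht.1, ht.2]

lemma hasDerivAt_const_sub_sq (c t : ℝ) : HasDerivAt (fun s : ℝ => c - s ^ 2) (-(2 * t)) t := by
  simpa using (hasDerivAt_pow 2 t).const_sub c

lemma hasDerivAt_one_sub_sq_rpow (μ : ℝ) {t : ℝ} (ht : t ∈ Ioo (-1 : ℝ) 1) :
    HasDerivAt (fun s : ℝ => (1 - s ^ 2) ^ μ) (-(2 * μ * t) * (1 - t ^ 2) ^ (μ - 1)) t := by
  convert (hasDerivAt_const_sub_sq 1 t).rpow_const (p := μ) (Or.inl (one_sub_sq_pos ht).ne') using 1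
  ring

lemma exists_oneSubSqDeriv_eq (j : ℕ) (μ : ℝ) :
    ∃ Q : Polynomial ℝ, ∀ t ∈ Ioo (-1 : ℝ) 1,
      oneSubSqDeriv j μ t = (1 - t ^ 2) ^ (μ - j) * Q.eval t := by
  induction j with
  | zero => exact ⟨1, fun t _ => by simp [oneSubSqDeriv]⟩
  | succ j ih =>
    obtain ⟨Q, hQ⟩ := ih
    refine ⟨Polynomial.C (-(2 * (μ - j))) * Polynomial.X * Q
      + (1 - Polynomial.X ^ 2) * Q.derivative, fun t ht => ?_⟩
    have hev : iteratedDeriv j (fun s : ℝ => (1 - s ^ 2) ^ μ)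
        =ᶠ[𝓝 t] fun s => (1 - s ^ 2) ^ (μ - j) * Q.eval s :=
      eventually_of_mem (Ioo_mem_nhds ht.1 ht.2) hQ
    rw [oneSubSqDeriv, iteratedDeriv_succ, hev.deriv_eq,
      ((hasDerivAt_one_sub_sq_rpow (μ - j) ht).fun_mul (Q.hasDerivAt t)).deriv]
    have hpow : (1 - t ^ 2) ^ (μ - j) = (1 - t ^ 2) ^ (μ - j - 1) * (1 - t ^ 2) := by
      rw [← Real.rpow_add_one (one_sub_sq_pos ht).ne', sub_add_cancel]
    rw [hpow, show μ - ((j + 1 : ℕ) : ℝ) = μ - j - 1 by push_cast; ring]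
    simp
    ring

lemma hasDerivAt_oneSubSqDeriv (j : ℕ) (μ : ℝ) {t : ℝ} (ht : t ∈ Ioo (-1 : ℝ) 1) :
    HasDerivAt (oneSubSqDeriv j μ) (oneSubSqDeriv (j + 1) μ t) t := by
  obtain ⟨Q, hQ⟩ := exists_oneSubSqDeriv_eq j μ
  have hev : oneSubSqDeriv j μ =ᶠ[𝓝 t] fun s => (1 - s ^ 2) ^ (μ - j) * Q.eval s :=
    eventually_of_mem (Ioo_mem_nhds ht.1 ht.2) hQ
  have hd := (((hasDerivAt_one_sub_sq_rpow (μ - j) ht).mul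
    (Q.hasDerivAt t)).congr_of_eventuallyEq hev).differentiableAt.hasDerivAt
  have hs : oneSubSqDeriv (j + 1) μ = deriv (oneSubSqDeriv j μ) := iteratedDeriv_succ
  rwa [hs]

lemma oneSubSqDeriv_zero (μ t : ℝ) : oneSubSqDeriv 0 μ t = (1 - t ^ 2) ^ μ := by
  simp [oneSubSqDeriv]

lemma oneSubSqDeriv_one_add_one (μ : ℝ) {t : ℝ} (ht : t ∈ Ioo (-1 : ℝ) 1) :
    oneSubSqDeriv 1 (μ + 1) t = -2 * (μ + 1) * (t * oneSubSqDeriv 0 μ t) := by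
  have h := hasDerivAt_one_sub_sq_rpow (μ + 1) ht
  rw [oneSubSqDeriv, iteratedDeriv_one, h.deriv, oneSubSqDeriv_zero, add_sub_cancel_right]
  ring

lemma oneSubSqDeriv_one (μ : ℝ) {t : ℝ} (ht : t ∈ Ioo (-1 : ℝ) 1) :
    (1 - t ^ 2) * oneSubSqDeriv 1 μ t = -2 * μ * t * oneSubSqDeriv 0 μ t := by
  have h := hasDerivAt_one_sub_sq_rpow μ ht
  rw [oneSubSqDeriv, iteratedDeriv_one, h.deriv, oneSubSqDeriv_zero,
    Real.rpow_sub_one (one_sub_sq_pos ht).ne']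
  field_simp [(one_sub_sq_pos ht).ne']

/-- Differentiating `d/dt (1 - t²)^(μ+1) = -2 (μ + 1) t (1 - t²)^μ` by the Leibniz rule. -/
lemma oneSubSqDeriv_add_two_eq_mul (j : ℕ) (μ : ℝ) : ∀ t ∈ Ioo (-1 : ℝ) 1,
    oneSubSqDeriv (j + 2) (μ + 1) t =
      -2 * (μ + 1) * (t * oneSubSqDeriv (j + 1) μ t + (j + 1) * oneSubSqDeriv j μ t) := by
  induction j with
  | zero =>
    intro t ht
    have hev : oneSubSqDeriv 1 (μ + 1) =ᶠ[𝓝 t]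
        fun s => -2 * (μ + 1) * (s * oneSubSqDeriv 0 μ s) :=
      eventually_of_mem (Ioo_mem_nhds ht.1 ht.2) fun s hs => oneSubSqDeriv_one_add_one μ hs
    have h := (((hasDerivAt_id t).mul (hasDerivAt_oneSubSqDeriv 0 μ ht)).const_mul
      (-2 * (μ + 1))).congr_of_eventuallyEq hev
    rw [(hasDerivAt_oneSubSqDeriv 1 (μ + 1) ht).unique h]
    simp only [id, Nat.cast_zero, zero_add]
    ring
  | succ j ih =>
    intro t ht
    have hev : oneSubSqDeriv (j + 2) (μ + 1) =ᶠ[𝓝 t] fun s =>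
        -2 * (μ + 1) * (s * oneSubSqDeriv (j + 1) μ s + (j + 1) * oneSubSqDeriv j μ s) :=
      eventually_of_mem (Ioo_mem_nhds ht.1 ht.2) ih
    have h := ((((hasDerivAt_id t).mul (hasDerivAt_oneSubSqDeriv (j + 1) μ ht)).add
      ((hasDerivAt_oneSubSqDeriv j μ ht).const_mul ((j : ℝ) + 1))).const_mul
      (-2 * (μ + 1))).congr_of_eventuallyEq hev
    rw [(hasDerivAt_oneSubSqDeriv (j + 2) (μ + 1) ht).unique h]
    push_cast
    simp only [id]
    ring

/-- Differentiating `(1 - t²)^(μ+1) = (1 - t²) (1 - t²)^μ` by the Leibniz rule. -/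
lemma oneSubSqDeriv_add_two_eq_sub (j : ℕ) (μ : ℝ) : ∀ t ∈ Ioo (-1 : ℝ) 1,
    oneSubSqDeriv (j + 2) (μ + 1) t =
      (1 - t ^ 2) * oneSubSqDeriv (j + 2) μ t - 2 * (j + 2) * t * oneSubSqDeriv (j + 1) μ t
        - (j + 2) * (j + 1) * oneSubSqDeriv j μ t := by
  induction j with
  | zero =>
    intro t ht
    have hev : oneSubSqDeriv 1 (μ + 1) =ᶠ[𝓝 t]
        fun s => (1 - s ^ 2) * oneSubSqDeriv 1 μ s - 2 * (s * oneSubSqDeriv 0 μ s) :=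
      eventually_of_mem (Ioo_mem_nhds ht.1 ht.2) fun s hs => by
        simp only [oneSubSqDeriv_one_add_one μ hs, oneSubSqDeriv_one μ hs]
        ring
    have h := (((hasDerivAt_const_sub_sq 1 t).mul (hasDerivAt_oneSubSqDeriv 1 μ ht)).sub
      (((hasDerivAt_id t).mul (hasDerivAt_oneSubSqDeriv 0 μ ht)).const_mul
        2)).congr_of_eventuallyEq hev
    rw [(hasDerivAt_oneSubSqDeriv 1 (μ + 1) ht).unique h]
    simp only [id, Nat.cast_zero, zero_add]
    ring
  | succ j ih =>
    intro t ht
    have hev : oneSubSqDeriv (j + 2) (μ + 1) =ᶠ[𝓝 t] fun s =>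
        (1 - s ^ 2) * oneSubSqDeriv (j + 2) μ s
          - 2 * (j + 2) * (s * oneSubSqDeriv (j + 1) μ s)
          - (j + 2) * (j + 1) * oneSubSqDeriv j μ s :=
      eventually_of_mem (Ioo_mem_nhds ht.1 ht.2) fun s hs => by
        simp only [ih s hs]
        ring
    have h := ((((hasDerivAt_const_sub_sq 1 t).mul (hasDerivAt_oneSubSqDeriv (j + 2) μ ht)).sub
      (((hasDerivAt_id t).mul (hasDerivAt_oneSubSqDeriv (j + 1) μ ht)).const_mul
        (2 * ((j : ℝ) + 2)))).sub ((hasDerivAt_oneSubSqDeriv j μ ht).const_mul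
        (((j : ℝ) + 2) * (j + 1)))).congr_of_eventuallyEq hev
    rw [(hasDerivAt_oneSubSqDeriv (j + 2) (μ + 1) ht).unique h]
    push_cast
    simp only [id]
    ring

lemma continuous_mul_one_sub_sq_rpow_mul {c : ℝ → ℝ} (hc : Continuous c) {μ : ℝ} (hμ : 0 ≤ μ)
    (Q : Polynomial ℝ) : Continuous fun t : ℝ => c t * ((1 - t ^ 2) ^ μ * Q.eval t) :=
  hc.mul (((by fun_prop : Continuous fun t : ℝ => 1 - t ^ 2).rpow_const fun _ => Or.inr hμ).mul
    Q.continuous)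

lemma tendsto_mul_oneSubSqDeriv {c : ℝ → ℝ} (hc : Continuous c) {j p : ℕ} {μ : ℝ}
    (h : j < μ + p) :
    Tendsto (fun t => c t * ((1 - t ^ 2) ^ p * oneSubSqDeriv j μ t)) (𝓝[>] (-1)) (𝓝 0) ∧
    Tendsto (fun t => c t * ((1 - t ^ 2) ^ p * oneSubSqDeriv j μ t)) (𝓝[<] 1) (𝓝 0) := by
  obtain ⟨Q, hQ⟩ := exists_oneSubSqDeriv_eq j μ
  have hpos : 0 < μ - j + p := by linarith
  have hcont := continuous_mul_one_sub_sq_rpow_mul hc hpos.le Q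
  have heq : ∀ t ∈ Ioo (-1 : ℝ) 1, c t * ((1 - t ^ 2) ^ (μ - j + p) * Q.eval t) =
      c t * ((1 - t ^ 2) ^ p * oneSubSqDeriv j μ t) := fun t ht => by
    rw [hQ t ht, Real.rpow_add_natCast (one_sub_sq_pos ht).ne']
    ring
  constructor
  · refine Tendsto.congr' (eventually_of_mem (Ioo_mem_nhdsGT (by norm_num)) heq) ?_
    simpa [Real.zero_rpow hpos.ne'] using (hcont.tendsto (-1)).mono_left nhdsWithin_le_nhds
  · refine Tendsto.congr' (eventually_of_mem (Ioo_mem_nhdsLT (by norm_num)) heq) ?_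
    simpa [Real.zero_rpow hpos.ne'] using (hcont.tendsto 1).mono_left nhdsWithin_le_nhds

lemma ofReal_betaIntegrand {u x : ℝ} (hx : x ∈ Ioo (0 : ℝ) 1) :
    (x : ℂ) ^ ((u : ℂ) - 1) * (1 - (x : ℂ)) ^ ((u : ℂ) - 1) =
      (((x * (1 - x)) ^ (u - 1) : ℝ) : ℂ) := by
  rw [Real.mul_rpow hx.1.le (by linarith [hx.2]), Complex.ofReal_mul,
    Complex.ofReal_cpow hx.1.le, Complex.ofReal_cpow (by linarith [hx.2])]
  push_cast
  rfl

lemma intervalIntegrable_mul_one_sub_rpow {μ : ℝ} (hμ : -1 < μ) :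
    IntervalIntegrable (fun x : ℝ => (x * (1 - x)) ^ μ) volume 0 1 := by
  have hre : 0 < ((μ + 1 : ℝ) : ℂ).re := by simpa using by linarith
  have h := (Complex.betaIntegral_convergent hre hre).congr_uIoo (g := fun x : ℝ =>
      (((x * (1 - x)) ^ μ : ℝ) : ℂ)) fun x hx => by
    rw [uIoo_of_le zero_le_one] at hx
    simpa using ofReal_betaIntegrand (u := μ + 1) hx
  rw [intervalIntegrable_iff] at h ⊢
  simpa [IntegrableOn] using h.re

lemma integral_mul_one_sub_rpow {μ : ℝ} (hμ : -1 < μ) :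
    ∫ x in (0 : ℝ)..1, (x * (1 - x)) ^ μ = Real.Gamma (μ + 1) ^ 2 / Real.Gamma (2 * μ + 2) := by
  have h := ProbabilityTheory.beta_eq_betaIntegralReal (μ + 1) (μ + 1)
    (by linarith) (by linarith)
  rw [ProbabilityTheory.beta, Complex.betaIntegral, intervalIntegral.integral_congr_Ioo_of_le
    zero_le_one (g := fun x : ℝ => (((x * (1 - x)) ^ μ : ℝ) : ℂ)) (fun x hx => by
      simpa using ofReal_betaIntegrand (u := μ + 1) hx),
    intervalIntegral.integral_ofReal, Complex.ofReal_re] at h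
  rw [← h]
  ring_nf

lemma intervalIntegrable_one_sub_sq_rpow {μ : ℝ} (hμ : -1 < μ) :
    IntervalIntegrable (fun t : ℝ => (1 - t ^ 2) ^ μ) volume (-1) 1 := by
  have h := (((intervalIntegrable_mul_one_sub_rpow hμ).comp_mul_left (c := 1 / 2)).comp_add_right
    1).const_mul (4 ^ μ)
  norm_num at h
  refine h.congr_uIoo fun t ht => ?_
  rw [uIoo_of_le (by norm_num)] at ht
  have h0 : 0 ≤ (1 / 2 * (t + 1)) * (1 - 1 / 2 * (t + 1)) := by nlinarith [ht.1, ht.2]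
  change 4 ^ μ * (1 / 2 * (t + 1) * (1 - 1 / 2 * (t + 1))) ^ μ = _
  rw [← Real.mul_rpow (by norm_num) h0]
  ring_nf

lemma integral_one_sub_sq_rpow {μ : ℝ} (hμ : -1 < μ) :
    ∫ t in (-1 : ℝ)..1, (1 - t ^ 2) ^ μ =
      √Real.pi * Real.Gamma (μ + 1) / Real.Gamma (μ + 3 / 2) := by
  have h := intervalIntegral.integral_comp_mul_add (a := 0) (b := 1)
    (fun t : ℝ => (1 - t ^ 2) ^ μ) two_ne_zero (-1)
  have h4 : ∫ x in (0 : ℝ)..1, (1 - (2 * x + -1) ^ 2) ^ μ =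
      4 ^ μ * ∫ x in (0 : ℝ)..1, (x * (1 - x)) ^ μ := by
    rw [← intervalIntegral.integral_const_mul]
    refine intervalIntegral.integral_congr_Ioo_of_le zero_le_one fun x hx => ?_
    rw [← Real.mul_rpow (by norm_num) (by nlinarith [hx.1, hx.2])]
    ring_nf
  rw [h4, integral_mul_one_sub_rpow hμ] at h
  norm_num at h
  have hd := Real.Gamma_mul_Gamma_add_half (μ + 1)
  have h1 : 0 < Real.Gamma (μ + 1) := Real.Gamma_pos_of_pos (by linarith)
  have h2 : 0 < Real.Gamma (μ + 3 / 2) := Real.Gamma_pos_of_pos (by linarith)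
  have h3 : 0 < Real.Gamma (2 * μ + 2) := Real.Gamma_pos_of_pos (by linarith)
  have hp : (2 : ℝ) ^ (1 - 2 * (μ + 1)) * 4 ^ μ * 2 = 1 := by
    rw [show (4 : ℝ) = 2 ^ (2 : ℝ) by norm_num, ← Real.rpow_mul (by norm_num),
      ← Real.rpow_add (by norm_num), ← Real.rpow_add_one (by norm_num)]
    ring_nf
    simp
  rw [show μ + 1 + 1 / 2 = μ + 3 / 2 by ring, show 2 * (μ + 1) = 2 * μ + 2 by ring] at hd
  rw [show 2 * (μ + 1) = 2 * μ + 2 by ring] at hp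
  have h' : ∫ t in (-1 : ℝ)..1, (1 - t ^ 2) ^ μ =
      2 * (4 ^ μ * (Real.Gamma (μ + 1) ^ 2 / Real.Gamma (2 * μ + 2))) := by linarith
  rw [h', eq_div_iff h2.ne']
  generalize Real.Gamma (μ + 1) = a at *
  generalize Real.Gamma (μ + 3 / 2) = b at *
  generalize Real.Gamma (2 * μ + 2) = c at *
  field_simp
  linear_combination (2 * 4 ^ μ) * hd + c * √Real.pi * hp

lemma intervalIntegrable_mul_oneSubSqDeriv {c : ℝ → ℝ} (hc : Continuous c) {j : ℕ} {μ : ℝ}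
    (h : j < μ + 1) :
    IntervalIntegrable (fun t => c t * oneSubSqDeriv j μ t) volume (-1) 1 := by
  obtain ⟨Q, hQ⟩ := exists_oneSubSqDeriv_eq j μ
  refine ((intervalIntegrable_one_sub_sq_rpow (μ := μ - j) (by linarith)).continuousOn_mul
    (by fun_prop : Continuous fun t => c t * Q.eval t).continuousOn).congr_uIoo fun t ht => ?_
  rw [uIoo_of_le (by norm_num)] at ht
  simp only [hQ t ht]
  ring

lemma integral_half_sub_sq_mul_oneSubSqDeriv_one {μ : ℝ} (hμ : 0 < μ) :
    ∫ t in (-1 : ℝ)..1, (1 / 2 - t ^ 2) * oneSubSqDeriv 1 μ t = 0 := by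
  have hc : Continuous fun t : ℝ => 1 / 2 - t ^ 2 := by fun_prop
  have h1 := tendsto_mul_oneSubSqDeriv hc (j := 0) (p := 0) (μ := μ) (by simpa)
  have h2 := tendsto_mul_oneSubSqDeriv (continuous_const (y := (1 / (μ + 1) : ℝ)))
    (j := 0) (p := 0) (μ := μ + 1) (by simpa using by linarith)
  have := intervalIntegral.integral_eq_sub_of_hasDerivAt_of_tendsto (by norm_num)
    (fun t ht => ?_) (intervalIntegrable_mul_oneSubSqDeriv hc (j := 1) (μ := μ) (by simpa))
    (h1.1.sub h2.1) (h1.2.sub h2.2)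
  · simpa using this
  · have hd := (((hasDerivAt_const_sub_sq (1 / 2) t).fun_mul
      (hasDerivAt_oneSubSqDeriv 0 μ ht))).fun_sub
      ((hasDerivAt_oneSubSqDeriv 0 (μ + 1) ht).const_mul (1 / (μ + 1)))
    simp only [pow_zero, one_mul]
    refine hd.congr_deriv ?_
    simp only [zero_add, oneSubSqDeriv_one_add_one μ ht]
    have : μ + 1 ≠ 0 := by linarith
    simp
    field_simp
    ring

lemma integral_half_sub_sq_mul_oneSubSqDeriv_two {μ : ℝ} (hμ : 1 < μ) :
    ∫ t in (-1 : ℝ)..1, (1 / 2 - t ^ 2) * oneSubSqDeriv 2 μ t =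
      -2 * ∫ t in (-1 : ℝ)..1, (1 - t ^ 2) ^ μ := by
  have hc : Continuous fun t : ℝ => 1 / 2 - t ^ 2 := by fun_prop
  have h1 := tendsto_mul_oneSubSqDeriv hc (j := 1) (p := 0) (μ := μ) (by simpa)
  have h2 := tendsto_mul_oneSubSqDeriv (by fun_prop : Continuous fun t : ℝ => 2 * t)
    (j := 0) (p := 0) (μ := μ) (by simpa using by linarith)
  have i1 := intervalIntegrable_mul_oneSubSqDeriv hc (j := 2) (μ := μ)
    (by push_cast; linarith)
  have i2 := intervalIntegrable_mul_oneSubSqDeriv (continuous_const (y := (2 : ℝ))) (j := 0)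
    (μ := μ) (by push_cast; linarith)
  have := intervalIntegral.integral_eq_sub_of_hasDerivAt_of_tendsto (by norm_num)
    (fun t ht => ?_) (i1.add i2) (h1.1.add h2.1) (h1.2.add h2.2)
  · rw [intervalIntegral.integral_add i1 i2, intervalIntegral.integral_const_mul] at this
    simp only [oneSubSqDeriv_zero] at this
    linarith
  · have hd := (((hasDerivAt_const_sub_sq (1 / 2) t).fun_mul
      (hasDerivAt_oneSubSqDeriv 1 μ ht))).fun_add
      (((hasDerivAt_id' t).const_mul 2).fun_mul (hasDerivAt_oneSubSqDeriv 0 μ ht))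
    simp only [pow_zero, one_mul]
    refine hd.congr_deriv ?_
    ring

lemma integral_half_sub_sq_mul_oneSubSqDeriv_add_three (j : ℕ) {μ : ℝ} (hμ : j + 2 < μ) :
    ∫ t in (-1 : ℝ)..1, (1 / 2 - t ^ 2) * oneSubSqDeriv (j + 3) μ t = 0 := by
  have hc : Continuous fun t : ℝ => 1 / 2 - t ^ 2 := by fun_prop
  have h1 := tendsto_mul_oneSubSqDeriv hc (j := j + 2) (p := 0) (μ := μ)
    (by push_cast; linarith)
  have h2 := tendsto_mul_oneSubSqDeriv (by fun_prop : Continuous fun t : ℝ => 2 * t)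
    (j := j + 1) (p := 0) (μ := μ) (by push_cast; linarith)
  have h3 := tendsto_mul_oneSubSqDeriv (continuous_const (y := (2 : ℝ))) (j := j) (p := 0)
    (μ := μ) (by push_cast; linarith)
  have := intervalIntegral.integral_eq_sub_of_hasDerivAt_of_tendsto (by norm_num)
    (fun t ht => ?_) (intervalIntegrable_mul_oneSubSqDeriv hc (j := j + 3) (μ := μ)
      (by push_cast; linarith)) ((h1.1.add h2.1).sub h3.1) ((h1.2.add h2.2).sub h3.2)
  · simpa using this
  · have hd := ((((hasDerivAt_const_sub_sq (1 / 2) t).fun_mul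
      (hasDerivAt_oneSubSqDeriv (j + 2) μ ht))).fun_add
      (((hasDerivAt_id' t).const_mul 2).fun_mul (hasDerivAt_oneSubSqDeriv (j + 1) μ ht))).fun_sub
      ((hasDerivAt_oneSubSqDeriv j μ ht).const_mul 2)
    simp only [pow_zero, one_mul]
    refine hd.congr_deriv ?_
    ring

lemma continuous_bergG2 : Continuous bergG2 := by
  unfold bergG2
  have : Continuous fun t : ℝ => (1 - t ^ 2) ^ ((1 : ℝ) / 2) :=
    (by fun_prop : Continuous fun t : ℝ => 1 - t ^ 2).rpow_const fun _ => Or.inr (by norm_num)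
  have := Real.continuous_arccos
  fun_prop

/-- Berg's function solves `(1 - t²) g' + t g = (1/2 - t²) / (2π)` on `(-1, 1)`. -/
lemma hasDerivAt_bergG2 {t : ℝ} (ht : t ∈ Ioo (-1 : ℝ) 1) :
    HasDerivAt bergG2 ((1 / (2 * Real.pi) * (1 / 2 - t ^ 2) - t * bergG2 t) / (1 - t ^ 2)) t := by
  have hpos := one_sub_sq_pos ht
  have h := ((((Real.hasDerivAt_arccos ht.1.ne' ht.2.ne).const_sub Real.pi).fun_mul
    (hasDerivAt_one_sub_sq_rpow (1 / 2) ht)).sub ((hasDerivAt_id' t).div_const 2)).const_mul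
    (1 / (2 * Real.pi))
  refine HasDerivAt.congr_deriv (f := bergG2) h ?_
  rw [bergG2, Real.sqrt_eq_rpow, Real.rpow_sub_one hpos.ne']
  have hs : (1 - t ^ 2) ^ ((1 : ℝ) / 2) * (1 - t ^ 2) ^ ((1 : ℝ) / 2) = 1 - t ^ 2 := by
    rw [← Real.rpow_add hpos]
    norm_num
  have hs0 : (1 - t ^ 2) ^ ((1 : ℝ) / 2) ≠ 0 := (Real.rpow_pos_of_pos hpos _).ne'
  generalize (1 - t ^ 2) ^ ((1 : ℝ) / 2) = s at *
  have := hpos.ne'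
  field_simp
  ring

/-- The pairing of Berg's function with the `k`-th Rodrigues derivative of exponent `lam`. -/
noncomputable def bergPairing (lam : ℝ) (k : ℕ) : ℝ :=
  ∫ t in (-1 : ℝ)..1, bergG2 t * oneSubSqDeriv k (lam + k) t

lemma bergPairing_recurrence {lam : ℝ} (hlam : -1 < lam) (j : ℕ) :
    1 / (2 * Real.pi) * (∫ t in (-1 : ℝ)..1,
      (1 / 2 - t ^ 2) * oneSubSqDeriv (j + 1) (lam + j + 1) t) =
    -((2 * lam + 3) / (2 * (lam + j + 2))) * bergPairing lam (j + 2)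
      + (j + 1) * (j - 1) * bergPairing (lam + 1) j := by
  have hc : Continuous fun t : ℝ => 1 / 2 - t ^ 2 := by fun_prop
  have i0 := (intervalIntegrable_mul_oneSubSqDeriv hc (j := j + 1) (μ := lam + j + 1)
    (by push_cast; linarith)).const_mul (1 / (2 * Real.pi))
  have i1 := (intervalIntegrable_mul_oneSubSqDeriv continuous_bergG2 (j := j + 2)
    (μ := lam + j + 2) (by push_cast; linarith)).const_mul ((2 * lam + 3) / (2 * (lam + j + 2)))
  have i2 := (intervalIntegrable_mul_oneSubSqDeriv continuous_bergG2 (j := j)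
    (μ := lam + j + 1) (by linarith)).const_mul ((j + 1) * (j - 1))
  have hb := tendsto_mul_oneSubSqDeriv continuous_bergG2 (j := j + 1) (p := 1)
    (μ := lam + j + 1) (by push_cast; linarith)
  have key := intervalIntegral.integral_eq_sub_of_hasDerivAt_of_tendsto (by norm_num)
    (fun t ht => ?_) ((i0.add i1).sub i2) hb.1 hb.2
  · rw [intervalIntegral.integral_sub (i0.add i1) i2, intervalIntegral.integral_add i0 i1] at key
    simp only [intervalIntegral.integral_const_mul] at key
    simp only [bergPairing]
    rw [show lam + ((j + 2 : ℕ) : ℝ) = lam + j + 2 by push_cast; ring,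
      show lam + 1 + (j : ℝ) = lam + j + 1 by ring]
    linarith
  · have hd := (hasDerivAt_bergG2 ht).fun_mul
      ((hasDerivAt_const_sub_sq 1 t).fun_mul (hasDerivAt_oneSubSqDeriv (j + 1) (lam + j + 1) ht))
    simp only [pow_one]
    refine hd.congr_deriv ?_
    have e1 := oneSubSqDeriv_add_two_eq_mul j (lam + j + 1) t ht
    have e2 := oneSubSqDeriv_add_two_eq_sub j (lam + j + 1) t ht
    rw [show lam + j + 1 + 1 = lam + j + 2 by ring] at e1 e2
    have hpos := (one_sub_sq_pos ht).ne'
    have hne : lam + j + 2 ≠ 0 := by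
      have : (0 : ℝ) ≤ j := j.cast_nonneg
      linarith
    have e3 : (2 * lam + 3) / (2 * (lam + j + 2)) * oneSubSqDeriv (j + 2) (lam + j + 2) t =
        (1 - t ^ 2) * oneSubSqDeriv (j + 2) (lam + j + 1) t
          - 3 * t * oneSubSqDeriv (j + 1) (lam + j + 1) t
          + (j + 1) * (j - 1) * oneSubSqDeriv j (lam + j + 1) t := by
      have e1' : (2 * j + 1) / (2 * (lam + j + 2)) * oneSubSqDeriv (j + 2) (lam + j + 2) t =
          -(2 * j + 1) * (t * oneSubSqDeriv (j + 1) (lam + j + 1) t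
            + (j + 1) * oneSubSqDeriv j (lam + j + 1) t) := by
        rw [e1]
        field_simp
      have hsplit : (2 * lam + 3) / (2 * (lam + j + 2)) =
          1 - (2 * j + 1) / (2 * (lam + j + 2)) := by
        field_simp
        ring
      rw [hsplit]
      linear_combination e2 - e1'
    have e4 : (1 / (2 * Real.pi) * (1 / 2 - t ^ 2) - t * bergG2 t) / (1 - t ^ 2) * (1 - t ^ 2) =
        1 / (2 * Real.pi) * (1 / 2 - t ^ 2) - t * bergG2 t := div_mul_cancel₀ _ hpos
    linear_combination bergG2 t * (-e3) + oneSubSqDeriv (j + 1) (lam + j + 1) t * e4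

lemma bergPairing_zero {lam : ℝ} (hlam : -1 < lam) :
    bergPairing lam 0 = √Real.pi * Real.Gamma (lam + 3 / 2) / (4 * Real.Gamma (lam + 2)) := by
  have i1 := intervalIntegrable_mul_oneSubSqDeriv continuous_bergG2 (j := 0) (μ := lam)
    (by push_cast; linarith)
  have i2 := intervalIntegrable_mul_oneSubSqDeriv (continuous_bergG2.comp continuous_neg)
    (j := 0) (μ := lam) (by push_cast; linarith)
  have hneg : ∫ t in (-1 : ℝ)..1, bergG2 (-t) * oneSubSqDeriv 0 lam t = bergPairing lam 0 := by
    have h := intervalIntegral.integral_comp_neg (a := -1) (b := 1)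
      fun t : ℝ => bergG2 t * oneSubSqDeriv 0 lam t
    simp only [oneSubSqDeriv_zero, neg_neg, even_two.neg_pow] at h
    simpa [bergPairing, oneSubSqDeriv_zero] using h
  have hsum : ∫ t in (-1 : ℝ)..1, (bergG2 t * oneSubSqDeriv 0 lam t
      + bergG2 (-t) * oneSubSqDeriv 0 lam t) =
      1 / 2 * ∫ t in (-1 : ℝ)..1, (1 - t ^ 2) ^ (lam + 1 / 2) := by
    rw [← intervalIntegral.integral_const_mul]
    refine intervalIntegral.integral_congr_Ioo_of_le (by norm_num) fun t ht => ?_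
    simp only [oneSubSqDeriv_zero, bergG2, Real.arccos_neg, even_two.neg_pow,
      Real.rpow_add (one_sub_sq_pos ht)]
    field_simp
    ring
  rw [intervalIntegral.integral_add i1 (by simpa using i2), hneg,
    integral_one_sub_sq_rpow (by linarith)] at hsum
  have h : bergPairing lam 0 = ∫ t in (-1 : ℝ)..1, bergG2 t * oneSubSqDeriv 0 lam t := by
    simp [bergPairing]
  rw [← h, show lam + 1 / 2 + 1 = lam + 3 / 2 by ring,
    show lam + 1 / 2 + 3 / 2 = lam + 2 by ring] at hsum
  rw [mul_comm (4 : ℝ), ← div_div]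
  linarith

lemma integral_half_sub_sq_mul_oneSubSqDeriv_eq_zero {lam : ℝ} (hlam : -1 < lam) {j : ℕ}
    (hj : j ≠ 1) :
    ∫ t in (-1 : ℝ)..1, (1 / 2 - t ^ 2) * oneSubSqDeriv (j + 1) (lam + j + 1) t = 0 := by
  match j, hj with
  | 0, _ => exact integral_half_sub_sq_mul_oneSubSqDeriv_one (by push_cast; linarith)
  | i + 2, _ =>
    exact integral_half_sub_sq_mul_oneSubSqDeriv_add_three i (by push_cast; linarith)

theorem bergPairing_eq (k : ℕ) (hk : k ≠ 1) : ∀ lam : ℝ, -1 < lam →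
    bergPairing lam k = 1 / (2 * Real.pi) * ((-1) ^ (k + 1) * 2 ^ k / 4 * √Real.pi *
      Real.Gamma (lam + 1 + k) * Real.Gamma (lam + 3 / 2) * Real.Gamma (((k : ℝ) - 1) / 2) *
      Real.Gamma (((k : ℝ) + 1) / 2) /
      (Real.Gamma (lam + 1 + k / 2) * Real.Gamma (lam + 2 + k / 2))) := by
  induction k using Nat.twoStepInduction with
  | zero =>
    intro lam hlam
    have h1 : Real.Gamma (lam + 1) ≠ 0 := (Real.Gamma_pos_of_pos (by linarith)).ne'
    have h2 : Real.Gamma (lam + 2) ≠ 0 := (Real.Gamma_pos_of_pos (by linarith)).ne'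
    have hhalf := Real.Gamma_add_one (s := -1 / 2) (by norm_num)
    rw [show (-1 / 2 + 1 : ℝ) = 1 / 2 by norm_num, Real.Gamma_one_half_eq] at hhalf
    have hneg : Real.Gamma (-1 / 2) = -2 * √Real.pi := by linarith
    rw [bergPairing_zero hlam]
    simp only [Nat.cast_zero, zero_sub, zero_add, add_zero, zero_div, hneg,
      Real.Gamma_one_half_eq]
    have hpi := Real.mul_self_sqrt Real.pi_pos.le
    have hpi0 := Real.pi_ne_zero
    generalize Real.Gamma (lam + 3 / 2) = a at *
    field_simp
    linear_combination -a * hpi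
  | one => exact absurd rfl hk
  | more j ih _ =>
    intro lam hlam
    have hj0 : (0 : ℝ) ≤ j := j.cast_nonneg
    have hd1 : 0 < Real.Gamma (lam + 2 + j / 2) := Real.Gamma_pos_of_pos (by linarith)
    have hd2 : 0 < Real.Gamma (lam + 3 + j / 2) := Real.Gamma_pos_of_pos (by linarith)
    have hg1 := Real.Gamma_add_one (s := lam + 2 + j) (by linarith)
    have hg2 := Real.Gamma_add_one (s := lam + 3 / 2) (by linarith)
    have hg3 := Real.Gamma_add_one (s := ((j : ℝ) + 1) / 2) (by linarith)
    have hC1 : lam + j + 2 ≠ 0 := by linarith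
    have hC2 : 2 * lam + 3 ≠ 0 := by linarith
    have hpi0 := Real.pi_ne_zero
    have hX : bergPairing lam (j + 2) = 2 * (lam + j + 2) / (2 * lam + 3) *
        ((j + 1) * (j - 1) * bergPairing (lam + 1) j - 1 / (2 * Real.pi) *
          ∫ t in (-1 : ℝ)..1, (1 / 2 - t ^ 2) * oneSubSqDeriv (j + 1) (lam + j + 1) t) := by
      rw [bergPairing_recurrence hlam j]
      field_simp
      ring
    rw [hX]
    push_cast
    rw [show lam + 1 + ((j : ℝ) + 2) = lam + 2 + j + 1 by ring, hg1,
      show ((j : ℝ) + 2 - 1) / 2 = (j + 1) / 2 by ring,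
      show ((j : ℝ) + 2 + 1) / 2 = (j + 1) / 2 + 1 by ring, hg3,
      show lam + 1 + ((j : ℝ) + 2) / 2 = lam + 2 + j / 2 by ring,
      show lam + 2 + ((j : ℝ) + 2) / 2 = lam + 3 + j / 2 by ring]
    by_cases hj : j = 1
    · subst hj
      have hint : ∫ t in (-1 : ℝ)..1,
          (1 / 2 - t ^ 2) * oneSubSqDeriv (1 + 1) (lam + (1 : ℕ) + 1) t =
          -2 * (√Real.pi * Real.Gamma (lam + 3) / Real.Gamma (lam + 7 / 2)) := by
        rw [integral_half_sub_sq_mul_oneSubSqDeriv_two (by push_cast; linarith),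
          integral_one_sub_sq_rpow (by push_cast; linarith)]
        push_cast
        ring_nf
      rw [hint]
      norm_num at hd1 hd2 hg2 ⊢
      rw [show lam + 3 + 1 / 2 = lam + 7 / 2 by ring] at hd2 ⊢
      rw [show lam + 2 + 1 / 2 = lam + 5 / 2 by ring] at hd1 ⊢
      rw [show lam + 3 / 2 + 1 = lam + 5 / 2 by ring] at hg2
      rw [show lam + 2 + 1 = lam + 3 by ring, hg2]
      have hb : Real.Gamma (lam + 3 / 2) ≠ 0 := (Real.Gamma_pos_of_pos (by linarith)).ne'
      generalize Real.Gamma (lam + 7 / 2) = d2 at *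
      generalize Real.Gamma (lam + 3) = a at *
      generalize Real.Gamma (lam + 3 / 2) = b at *
      field_simp
      ring
    · have hj1 : (j : ℝ) - 1 ≠ 0 := sub_ne_zero.2 (by exact_mod_cast hj)
      have hg4 := Real.Gamma_add_one (s := ((j : ℝ) - 1) / 2) (by simpa using hj1)
      rw [show ((j : ℝ) - 1) / 2 + 1 = (j + 1) / 2 by ring] at hg4
      rw [integral_half_sub_sq_mul_oneSubSqDeriv_eq_zero hlam hj, mul_zero, sub_zero,
        ih hj (lam + 1) (by linarith),
        show lam + 1 + 1 + (j : ℝ) = lam + 2 + j by ring,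
        show lam + 1 + 3 / 2 = lam + 3 / 2 + 1 by ring, hg2,
        show lam + 1 + 1 + (j : ℝ) / 2 = lam + 2 + j / 2 by ring,
        show lam + 1 + 2 + (j : ℝ) / 2 = lam + 3 + j / 2 by ring, hg4]
      generalize Real.Gamma (lam + 2 + j / 2) = d1 at *
      generalize Real.Gamma (lam + 3 + j / 2) = d2 at *
      generalize Real.Gamma (lam + 2 + j) = a at *
      generalize Real.Gamma (lam + 3 / 2) = b at *
      generalize Real.Gamma ((j - 1) / 2) = c at *
      have := hd1.ne'
      have := hd2.ne'
      field_simp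
      ring

lemma ascPochhammer_eval_mul_Gamma (k : ℕ) {x : ℝ} (hx : 0 < x) :
    (ascPochhammer ℝ k).eval x * Real.Gamma x = Real.Gamma (x + k) := by
  induction k with
  | zero => simp
  | succ k ih =>
    rw [ascPochhammer_succ_eval, mul_right_comm, ih, Nat.cast_succ, ← add_assoc,
      Real.Gamma_add_one (by positivity)]
    ring

/-- the multipliers of C. Berg's function `g₂`:
`ω_{n−1} ∫_{−1}^{1} g₂(t) P_k^n(t) (1−t²)^{(n−3)/2} dt
  = −(π^{(n−2)/2}/4) Γ(n/2) Γ((k−1)/2) Γ((k+1)/2) / (Γ((n+k−1)/2) Γ((n+k+1)/2))`. -/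
theorem berg_g2_multipliers (n : ℕ) (hn : 2 ≤ n) (k : ℕ) (hk : k ≠ 1) :
    omegaBall (n - 1) *
      ∫ t in (-1 : ℝ)..1, bergG2 t * legendreP n k t * (1 - t ^ 2) ^ (((n : ℝ) - 3) / 2)
    = -(Real.pi ^ (((n : ℝ) - 2) / 2) / 4) * Real.Gamma ((n : ℝ) / 2) *
        Real.Gamma (((k : ℝ) - 1) / 2) * Real.Gamma (((k : ℝ) + 1) / 2) /
        (Real.Gamma (((n : ℝ) + (k : ℝ) - 1) / 2) * Real.Gamma (((n : ℝ) + (k : ℝ) + 1) / 2)) := by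
  have hn' : (2 : ℝ) ≤ n := by exact_mod_cast hn
  set lam : ℝ := ((n : ℝ) - 3) / 2 with hlam
  have hlam1 : -1 < lam := by linarith
  have hint : ∫ t in (-1 : ℝ)..1, bergG2 t * legendreP n k t * (1 - t ^ 2) ^ lam =
      (-1) ^ k / (2 ^ k * (ascPochhammer ℝ k).eval (lam + 1)) * bergPairing lam k := by
    rw [bergPairing, ← intervalIntegral.integral_const_mul]
    refine intervalIntegral.integral_congr_Ioo_of_le (by norm_num) fun t ht => ?_
    have hp : (1 - t ^ 2) ^ (-lam) * (1 - t ^ 2) ^ lam = 1 := by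
      rw [← Real.rpow_add (one_sub_sq_pos ht), neg_add_cancel, Real.rpow_zero]
    simp only [legendreP, oneSubSqDeriv, ← hlam, show ((n : ℝ) - 1) / 2 = lam + 1 by
      rw [hlam]; ring]
    linear_combination (bergG2 t * ((-1) ^ k / (2 ^ k * (ascPochhammer ℝ k).eval (lam + 1))) *
      iteratedDeriv k (fun s : ℝ => (1 - s ^ 2) ^ (lam + (k : ℝ))) t) * hp
  have hpoch := ascPochhammer_eval_mul_Gamma k (show 0 < lam + 1 by linarith)
  have hk0 : (0 : ℝ) ≤ k := k.cast_nonneg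
  have g1 : 0 < Real.Gamma (lam + 1) := Real.Gamma_pos_of_pos (by linarith)
  have g2 : 0 < Real.Gamma (lam + 1 + k) := Real.Gamma_pos_of_pos (by linarith)
  have g3 : 0 < Real.Gamma (lam + 1 + k / 2) := Real.Gamma_pos_of_pos (by linarith)
  have g4 : 0 < Real.Gamma (lam + 2 + k / 2) := Real.Gamma_pos_of_pos (by linarith)
  have hP0 : (ascPochhammer ℝ k).eval (lam + 1) ≠ 0 := fun h0 => by
    rw [h0, zero_mul] at hpoch
    exact g2.ne hpoch
  have hsign : (-1 : ℝ) ^ k * (-1) ^ (k + 1) = -1 := by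
    rw [← pow_add, Odd.neg_one_pow ⟨k, by ring⟩]
  have hpi : Real.pi ^ (lam + 1) = Real.pi ^ (lam + 1 / 2) * √Real.pi := by
    rw [Real.sqrt_eq_rpow, ← Real.rpow_add Real.pi_pos]
    ring_nf
  have hss := Real.mul_self_sqrt Real.pi_pos.le
  have hpi0 := Real.pi_ne_zero
  rw [hint, bergPairing_eq k hk lam hlam1, omegaBall, Nat.cast_sub (by lia), Nat.cast_one,
    show ((n : ℝ) - 1) / 2 = lam + 1 by rw [hlam]; ring,
    show ((n : ℝ) - 2) / 2 = lam + 1 / 2 by rw [hlam]; ring,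
    show (n : ℝ) / 2 = lam + 3 / 2 by rw [hlam]; ring,
    show ((n : ℝ) + k - 1) / 2 = lam + 1 + k / 2 by rw [hlam]; ring,
    show ((n : ℝ) + k + 1) / 2 = lam + 2 + k / 2 by rw [hlam]; ring, hpi, ← hpoch]
  generalize Real.Gamma (lam + 1) = a at *
  generalize Real.Gamma (lam + 3 / 2) = b at *
  generalize Real.Gamma (lam + 1 + k / 2) = d1 at *
  generalize Real.Gamma (lam + 2 + k / 2) = d2 at *
  generalize Real.Gamma ((k - 1) / 2) = e1 at *
  generalize Real.Gamma ((k + 1) / 2) = e2 at *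
  generalize (ascPochhammer ℝ k).eval (lam + 1) = P at *
  generalize Real.pi ^ (lam + 1 / 2) = q at *
  have := g1.ne'
  have := g3.ne'
  have := g4.ne'
  field_simp
  linear_combination (q * √Real.pi ^ 2 * b * e1 * e2) * hsign - q * b * e1 * e2 * hss
end

section
/- For every integer n ≥ 3 and every natural number k with k ≠ 1, ω_{n−1} · ∫_{−1}^{1} g_3(t) · P_k^n(t) · (1−t²)^{(n−3)/2} dt = −(π^{(n−3)/2}/2) · Γ((n−1)/2) · Γ((k−1)/2) · Γ((k+2)/2) / (Γ((n+k−2)/2) · Γ((n+k+1)/2)). -/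
/-- C. Berg's function `g₃`. -/
noncomputable def bergG3 (t : ℝ) : ℝ :=
  (1 / (2 * Real.pi)) * (1 + t * Real.log (1 - t) + (4 / 3 - Real.log 2) * t)

open MeasureTheory intervalIntegral Set Filter Topology in
/-- Integration by parts on an interval, where the product of the two functions extends
continuously to the closed interval with boundary values zero. -/
theorem integral_mul_deriv_eq_neg_of_eqOn {a b : ℝ} (hab : a ≤ b) {f f' u u' G : ℝ → ℝ}
    (hf : ∀ t ∈ Ioo a b, HasDerivAt f (f' t) t) (hu : ∀ t ∈ Ioo a b, HasDerivAt u (u' t) t)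
    (hG : ContinuousOn G (Icc a b)) (hGa : G a = 0) (hGb : G b = 0)
    (hfu : EqOn G (fun t => f t * u t) (Ioo a b))
    (hfu' : IntervalIntegrable (fun t => f t * u' t) volume a b)
    (hf'u : IntervalIntegrable (fun t => f' t * u t) volume a b) :
    ∫ t in a..b, f t * u' t = -∫ t in a..b, f' t * u t := by
  have h : ∫ t in a..b, (f' t * u t + f t * u' t) = G b - G a := by
    refine integral_eq_sub_of_hasDerivAt_of_le hab hG (fun t ht => ?_) (hf'u.add hfu')
    exact ((hf t ht).mul (hu t ht)).congr_of_eventuallyEq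
      (eventually_of_mem (isOpen_Ioo.mem_nhds ht) hfu)
  rw [integral_add hf'u hfu', hGa, hGb] at h
  linarith

theorem one_sub_sq_pos_of_mem_Ioo {t : ℝ} (ht : t ∈ Set.Ioo (-1 : ℝ) 1) : 0 < 1 - t ^ 2 := by
  nlinarith [ht.1, ht.2]

open Set Filter Topology Polynomial in
theorem exists_iteratedDeriv_one_sub_sq_rpow (b : ℝ) (j : ℕ) :
    ∃ q : ℝ[X], ∀ t ∈ Ioo (-1 : ℝ) 1,
      iteratedDeriv j (fun s : ℝ => (1 - s ^ 2) ^ b) t = (1 - t ^ 2) ^ (b - j) * q.eval t := by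
  induction j with
  | zero => exact ⟨1, fun t _ => by simp⟩
  | succ j ih =>
    obtain ⟨q, hq⟩ := ih
    refine ⟨C (-2 * (b - j)) * X * q + (1 - X ^ 2) * derivative q, fun t ht => ?_⟩
    have hpos := one_sub_sq_pos_of_mem_Ioo ht
    rw [iteratedDeriv_succ]
    have hx : HasDerivAt (fun s : ℝ => 1 - s ^ 2) (-(2 * t)) t := by
      simpa using (hasDerivAt_pow 2 t).const_sub 1
    have h1 := (hx.rpow_const (p := b - j) (Or.inl hpos.ne')).mul (q.hasDerivAt t)
    have h2 : iteratedDeriv j (fun s : ℝ => (1 - s ^ 2) ^ b) =ᶠ[𝓝 t]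
        (fun s : ℝ => (1 - s ^ 2) ^ (b - j)) * fun s => q.eval s :=
      eventually_of_mem (isOpen_Ioo.mem_nhds ht) hq
    rw [h2.deriv_eq, h1.deriv]
    have e1 : (1 - t ^ 2) ^ (b - j) = (1 - t ^ 2) ^ (b - j - 1) * (1 - t ^ 2) := by
      rw [← Real.rpow_add_one hpos.ne']; congr 1; ring
    have e2 : b - ((j + 1 : ℕ) : ℝ) = b - j - 1 := by push_cast; ring
    rw [e1, e2]
    simp only [eval_add, eval_mul, eval_C, eval_X, eval_sub, eval_one, eval_pow]
    ring

open Set Filter Topology in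
theorem hasDerivAt_iteratedDeriv_one_sub_sq_rpow (b : ℝ) (j : ℕ) {t : ℝ}
    (ht : t ∈ Ioo (-1 : ℝ) 1) :
    HasDerivAt (iteratedDeriv j (fun s : ℝ => (1 - s ^ 2) ^ b))
      (iteratedDeriv (j + 1) (fun s : ℝ => (1 - s ^ 2) ^ b) t) t := by
  obtain ⟨q, hq⟩ := exists_iteratedDeriv_one_sub_sq_rpow b j
  rw [iteratedDeriv_succ]
  apply DifferentiableAt.hasDerivAt
  have hpos := one_sub_sq_pos_of_mem_Ioo ht
  have h : DifferentiableAt ℝ (fun s : ℝ => (1 - s ^ 2) ^ (b - j) * q.eval s) t :=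
    (DifferentiableAt.rpow_const (f := fun s : ℝ => 1 - s ^ 2) (by fun_prop)
      (Or.inl hpos.ne')).mul q.differentiableAt
  exact h.congr_of_eventuallyEq (eventually_of_mem (isOpen_Ioo.mem_nhds ht) hq)

/-- `f` has at `1` at worst a pole of order `i`, up to a logarithmic factor. -/
def HasLogPoleAtOne (i : ℕ) (f : ℝ → ℝ) : Prop :=
  ∃ A B : ℝ → ℝ, Continuous A ∧ Continuous B ∧
    ∀ t < 1, f t * (1 - t) ^ i = A t * Real.log (1 - t) + B t

theorem continuous_one_sub_sq_rpow {a : ℝ} (ha : 0 ≤ a) :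
    Continuous fun t : ℝ => (1 - t ^ 2) ^ a :=
  Continuous.rpow_const (by fun_prop) fun _ => Or.inr ha

open MeasureTheory in
theorem intervalIntegrable_log_one_sub (a b : ℝ) :
    IntervalIntegrable (fun t : ℝ => Real.log (1 - t)) volume a b := by
  have h := (intervalIntegral.intervalIntegrable_log' (a := 1 - a) (b := 1 - b)).comp_sub_left 1
  simpa using h

theorem one_sub_sq_rpow_add_nat {t : ℝ} (ht : t ∈ Set.Ioo (-1 : ℝ) 1) (a : ℝ) (i : ℕ) :
    (1 - t ^ 2) ^ (a + i) = (1 - t) ^ i * ((1 + t) ^ i * (1 - t ^ 2) ^ a) := by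
  rw [Real.rpow_add_natCast (one_sub_sq_pos_of_mem_Ioo ht).ne', ← mul_assoc, ← mul_pow]
  ring

open MeasureTheory Set in
theorem HasLogPoleAtOne.intervalIntegrable_mul_iteratedDeriv {i : ℕ} {f : ℝ → ℝ}
    (hf : HasLogPoleAtOne i f) {a : ℝ} (ha : 0 ≤ a) (j : ℕ) :
    IntervalIntegrable
      (fun t => f t * iteratedDeriv j (fun s : ℝ => (1 - s ^ 2) ^ (a + i + j)) t)
      volume (-1) 1 := by
  obtain ⟨A, B, hA, hB, hAB⟩ := hf
  obtain ⟨q, hq⟩ := exists_iteratedDeriv_one_sub_sq_rpow (a + i + j) j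
  have hw := continuous_one_sub_sq_rpow ha
  have hi : IntervalIntegrable (fun t : ℝ =>
      Real.log (1 - t) * (A t * (1 + t) ^ i * (1 - t ^ 2) ^ a * q.eval t) +
        B t * (1 + t) ^ i * (1 - t ^ 2) ^ a * q.eval t) volume (-1) 1 :=
    ((intervalIntegrable_log_one_sub _ _).mul_continuousOn
      (Continuous.continuousOn (by fun_prop))).add
      (Continuous.intervalIntegrable (by fun_prop) _ _)
  refine hi.congr_uIoo fun t ht => ?_
  rw [uIoo_of_le (by norm_num)] at ht
  simp only
  rw [hq t ht, add_sub_cancel_right, one_sub_sq_rpow_add_nat ht]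
  linear_combination -((1 + t) ^ i * (1 - t ^ 2) ^ a * q.eval t) * hAB t ht.2

open MeasureTheory Set in
theorem integral_mul_iteratedDeriv_succ_one_sub_sq_rpow {i : ℕ} {f f' : ℝ → ℝ}
    (hf : HasLogPoleAtOne i f) (hf' : HasLogPoleAtOne (i + 1) f')
    (hff' : ∀ t ∈ Ioo (-1 : ℝ) 1, HasDerivAt f (f' t) t) {a : ℝ} (ha : 0 ≤ a) (j : ℕ) :
    ∫ t in (-1 : ℝ)..1,
        f t * iteratedDeriv (j + 1) (fun s : ℝ => (1 - s ^ 2) ^ (a + (i + j + 1 : ℕ))) t =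
      -∫ t in (-1 : ℝ)..1,
        f' t * iteratedDeriv j (fun s : ℝ => (1 - s ^ 2) ^ (a + (i + j + 1 : ℕ))) t := by
  have hint := hf.intervalIntegrable_mul_iteratedDeriv ha (j + 1)
  have hint' := hf'.intervalIntegrable_mul_iteratedDeriv ha j
  have e1 : a + i + ((j + 1 : ℕ) : ℝ) = a + (i + j + 1 : ℕ) := by push_cast; ring
  have e2 : a + ((i + 1 : ℕ) : ℝ) + j = a + (i + j + 1 : ℕ) := by push_cast; ring
  rw [e1] at hint
  rw [e2] at hint'
  obtain ⟨A, B, hA, hB, hAB⟩ := hf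
  obtain ⟨q, hq⟩ := exists_iteratedDeriv_one_sub_sq_rpow (a + (i + j + 1 : ℕ)) j
  have hw := continuous_one_sub_sq_rpow ha
  have hlog : Continuous fun t : ℝ => (1 - t) * Real.log (1 - t) :=
    Real.continuous_mul_log.comp (continuous_const.sub continuous_id)
  refine integral_mul_deriv_eq_neg_of_eqOn
    (G := fun t => (A t * ((1 - t) * Real.log (1 - t)) + B t * (1 - t)) *
      ((1 + t) ^ (i + 1) * (1 - t ^ 2) ^ a * q.eval t))
    (by norm_num) hff' (fun t ht => hasDerivAt_iteratedDeriv_one_sub_sq_rpow _ j ht)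
    (Continuous.continuousOn (by fun_prop)) (by simp) (by simp) (fun t ht => ?_) hint hint'
  simp only
  rw [hq t ht, show a + ((i + j + 1 : ℕ) : ℝ) - j = a + (i + 1 : ℕ) by push_cast; ring,
    one_sub_sq_rpow_add_nat ht]
  linear_combination -((1 - t) * (1 + t) ^ (i + 1) * (1 - t ^ 2) ^ a * q.eval t) * hAB t ht.2

/-- The successive derivatives of `t ↦ 1 + t * log (1 - t) + c * t` on `t < 1`. -/
noncomputable def bergDeriv (c : ℝ) : ℕ → ℝ → ℝ
  | 0, t => 1 + t * Real.log (1 - t) + c * t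
  | 1, t => Real.log (1 - t) - t / (1 - t) + c
  | i + 2, t => -(i.factorial / (1 - t) ^ (i + 1) + (i + 1).factorial / (1 - t) ^ (i + 2))

theorem hasLogPoleAtOne_bergDeriv (c : ℝ) (i : ℕ) : HasLogPoleAtOne i (bergDeriv c i) := by
  match i with
  | 0 =>
    exact ⟨fun t => t, fun t => 1 + c * t, by fun_prop, by fun_prop, fun t _ => by
      simp only [bergDeriv]; ring⟩
  | 1 =>
    refine ⟨fun t => 1 - t, fun t => -t + c * (1 - t), by fun_prop, by fun_prop, fun t ht => ?_⟩
    have : 1 - t ≠ 0 := by linarith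
    simp only [bergDeriv]
    field_simp
    ring
  | i + 2 =>
    refine ⟨fun _ => 0, fun t => -(i.factorial * (1 - t) + (i + 1).factorial),
      by fun_prop, by fun_prop, fun t ht => ?_⟩
    have : 1 - t ≠ 0 := by linarith
    simp only [bergDeriv]
    field_simp
    ring

theorem hasDerivAt_bergDeriv (c : ℝ) (i : ℕ) {t : ℝ} (ht : t < 1) :
    HasDerivAt (bergDeriv c i) (bergDeriv c (i + 1) t) t := by
  have h0 : 1 - t ≠ 0 := by linarith
  have hx : HasDerivAt (fun s : ℝ => 1 - s) (-1) t := by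
    simpa using (hasDerivAt_id t).const_sub 1
  have hl := hx.log h0
  match i with
  | 0 =>
    have h := (((hasDerivAt_id t).mul hl).const_add 1).add ((hasDerivAt_id t).const_mul c)
    refine h.congr_deriv ?_
    simp only [bergDeriv, id]
    field_simp
    ring
  | 1 =>
    have h := (hl.sub ((hasDerivAt_id t).div hx h0)).add_const c
    refine h.congr_deriv ?_
    simp only [bergDeriv, id, Nat.factorial]
    field_simp
    push_cast
    ring
  | i + 2 =>
    have hp (m : ℕ) : HasDerivAt (fun s : ℝ => (m.factorial : ℝ) / (1 - s) ^ (m + 1))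
        ((m + 1).factorial / (1 - t) ^ (m + 2)) t := by
      refine ((hasDerivAt_const t (m.factorial : ℝ)).div (hx.pow (m + 1))
        (pow_ne_zero _ h0)).congr_deriv ?_
      simp only [Nat.factorial_succ, Pi.pow_apply, Nat.add_sub_cancel]
      field_simp
      push_cast
      ring
    exact ((hp i).add (hp (i + 1))).neg

theorem integral_bergDeriv_mul_iteratedDeriv (c : ℝ) {a : ℝ} (ha : 0 ≤ a) (k : ℕ) :
    ∫ t in (-1 : ℝ)..1,
        bergDeriv c 0 t * iteratedDeriv k (fun s : ℝ => (1 - s ^ 2) ^ (a + k)) t =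
      (-1) ^ k * ∫ t in (-1 : ℝ)..1, bergDeriv c k t * (1 - t ^ 2) ^ (a + k) := by
  have key (i : ℕ) : ∀ j, i + j = k →
      ∫ t in (-1 : ℝ)..1,
        bergDeriv c i t * iteratedDeriv j (fun s : ℝ => (1 - s ^ 2) ^ (a + k)) t =
      (-1) ^ j * ∫ t in (-1 : ℝ)..1, bergDeriv c k t * (1 - t ^ 2) ^ (a + k) := by
    intro j
    induction j generalizing i with
    | zero => rintro rfl; simp
    | succ j ih =>
      rintro rfl
      have h := integral_mul_iteratedDeriv_succ_one_sub_sq_rpow (hasLogPoleAtOne_bergDeriv c i)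
        (hasLogPoleAtOne_bergDeriv c (i + 1)) (fun t ht => hasDerivAt_bergDeriv c i ht.2) ha j
      rw [← add_assoc, h, add_assoc i j 1, ih (i + 1) (by ring)]
      ring
  exact key 0 k (zero_add k)

theorem integral_one_sub_rpow_mul_one_add_rpow {p q : ℝ} (hp : 0 ≤ p) (hq : 0 ≤ q) :
    ∫ t in (-1 : ℝ)..1, (1 - t) ^ p * (1 + t) ^ q =
      2 ^ (p + q + 1) * (Real.Gamma (p + 1) * Real.Gamma (q + 1) / Real.Gamma (p + q + 2)) := by
  have h1 : ((∫ x in (0 : ℝ)..1, x ^ p * (1 - x) ^ q : ℝ) : ℂ) =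
      Complex.betaIntegral ((p + 1 : ℝ) : ℂ) ((q + 1 : ℝ) : ℂ) := by
    rw [Complex.betaIntegral, ← intervalIntegral.integral_ofReal]
    refine intervalIntegral.integral_congr_Ioo_of_le (by norm_num) fun x hx => ?_
    have hx1 : 0 ≤ 1 - x := by linarith [hx.2]
    simp only [Complex.ofReal_mul, Complex.ofReal_cpow hx.1.le, Complex.ofReal_cpow hx1]
    push_cast
    simp
  have h2 : ∫ x in (0 : ℝ)..1, x ^ p * (1 - x) ^ q =
      Real.Gamma (p + 1) * Real.Gamma (q + 1) / Real.Gamma (p + q + 2) := by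
    have h := ProbabilityTheory.beta_eq_betaIntegralReal (p + 1) (q + 1) (by linarith)
      (by linarith)
    rw [← h1, Complex.ofReal_re] at h
    rw [← h, ProbabilityTheory.beta]
    congr 2; ring
  rw [← h2]
  have h3 := intervalIntegral.integral_comp_sub_mul (a := 0) (b := 1)
    (fun t : ℝ => (1 - t) ^ p * (1 + t) ^ q) (two_ne_zero (α := ℝ)) 1
  have h4 : ∫ x in (0 : ℝ)..1, (1 - (1 - 2 * x)) ^ p * (1 + (1 - 2 * x)) ^ q =
      2 ^ (p + q) * ∫ x in (0 : ℝ)..1, x ^ p * (1 - x) ^ q := by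
    rw [← intervalIntegral.integral_const_mul]
    refine intervalIntegral.integral_congr_Ioo_of_le (by norm_num) fun x hx => ?_
    have hx1 : 0 ≤ 1 - x := by linarith [hx.2]
    rw [show 1 - (1 - 2 * x) = 2 * x by ring, show 1 + (1 - 2 * x) = 2 * (1 - x) by ring,
      Real.mul_rpow (by norm_num) hx.1.le, Real.mul_rpow (by norm_num) hx1,
      Real.rpow_add (by norm_num)]
    ring
  rw [h4] at h3
  norm_num at h3
  rw [Real.rpow_add_one (by norm_num)]
  linarith

theorem Real.Gamma_add_nat_eq_ascPochhammer_mul {x : ℝ} (hx : 0 < x) (k : ℕ) :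
    Real.Gamma (x + k) = (ascPochhammer ℝ k).eval x * Real.Gamma x := by
  induction k with
  | zero => simp
  | succ k ih =>
    rw [Nat.cast_succ, ← add_assoc, Real.Gamma_add_one (by positivity), ih,
      ascPochhammer_succ_eval]
    ring

theorem one_sub_sq_rpow_eq {t : ℝ} (ht : t ∈ Set.Ioo (-1 : ℝ) 1) (a : ℝ) :
    (1 - t ^ 2) ^ a = (1 - t) ^ a * (1 + t) ^ a := by
  rw [← Real.mul_rpow (by linarith [ht.2]) (by linarith [ht.1])]
  ring_nf

open MeasureTheory in
theorem intervalIntegrable_one_sub_rpow_mul_one_add_rpow {p q : ℝ} (hp : 0 ≤ p) (hq : 0 ≤ q)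
    (a b : ℝ) : IntervalIntegrable (fun t : ℝ => (1 - t) ^ p * (1 + t) ^ q) volume a b :=
  (((continuous_const.sub continuous_id).rpow_const fun _ => Or.inr hp).mul
    ((continuous_const.add continuous_id).rpow_const fun _ => Or.inr hq)).intervalIntegrable _ _

theorem integral_bergDeriv_mul_one_sub_sq_rpow (c : ℝ) {a : ℝ} (ha : 0 ≤ a) (m : ℕ) :
    ∫ t in (-1 : ℝ)..1, bergDeriv c (m + 2) t * (1 - t ^ 2) ^ (a + (m + 2 : ℕ)) =
      -(m.factorial * (m + 2) * 2 ^ (2 * a + m + 3) * Real.Gamma (a + 1) *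
        Real.Gamma (a + m + 3) / ((2 * a + m + 4) * Real.Gamma (2 * a + m + 3))) := by
  have hm : (0 : ℝ) ≤ m := m.cast_nonneg
  have h1 : ∫ t in (-1 : ℝ)..1, bergDeriv c (m + 2) t * (1 - t ^ 2) ^ (a + (m + 2 : ℕ)) =
      ∫ t in (-1 : ℝ)..1, (-(m.factorial : ℝ) * ((1 - t) ^ (a + 1) * (1 + t) ^ (a + m + 2)) +
        -((m + 1).factorial : ℝ) * ((1 - t) ^ a * (1 + t) ^ (a + m + 2))) := by
    refine intervalIntegral.integral_congr_Ioo_of_le (by norm_num) fun t ht => ?_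
    have h0 : 0 < 1 - t := by linarith [ht.2]
    simp only [bergDeriv]
    rw [one_sub_sq_rpow_eq ht, Real.rpow_add_natCast h0.ne', Real.rpow_add_one h0.ne',
      show a + ((m + 2 : ℕ) : ℝ) = a + m + 2 by push_cast; ring]
    field_simp
    ring
  rw [h1, intervalIntegral.integral_add
    ((intervalIntegrable_one_sub_rpow_mul_one_add_rpow (by linarith) (by linarith) _ _).const_mul _)
    ((intervalIntegrable_one_sub_rpow_mul_one_add_rpow ha (by linarith) _ _).const_mul _),
    intervalIntegral.integral_const_mul, intervalIntegral.integral_const_mul,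
    integral_one_sub_rpow_mul_one_add_rpow (by linarith) (by linarith),
    integral_one_sub_rpow_mul_one_add_rpow ha (by linarith)]
  have hG : 0 < Real.Gamma (2 * a + m + 3) := Real.Gamma_pos_of_pos (by linarith)
  rw [show a + 1 + (a + m + 2) + 1 = (2 * a + m + 3) + 1 by ring,
    show a + (a + m + 2) + 1 = 2 * a + m + 3 by ring,
    show a + 1 + (a + m + 2) + 2 = (2 * a + m + 3) + 1 + 1 by ring,
    show a + (a + m + 2) + 2 = (2 * a + m + 3) + 1 by ring,
    show a + m + 2 + 1 = a + m + 3 by ring,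
    Real.Gamma_add_one (s := 2 * a + m + 3 + 1) (by positivity),
    Real.Gamma_add_one (s := 2 * a + m + 3) (by positivity),
    Real.Gamma_add_one (s := a + 1) (by positivity), Real.rpow_add_one (by norm_num),
    Nat.factorial_succ]
  have h3 : 2 * a + m + 3 ≠ 0 := by positivity
  have h4 : 2 * a + m + 3 + 1 ≠ 0 := by positivity
  have h5 : 2 * a + m + 4 ≠ 0 := by positivity
  push_cast
  field_simp
  ring

theorem integral_bergDeriv_zero_mul_one_sub_sq_rpow (c : ℝ) {a : ℝ} (ha : 0 ≤ a) :
    ∫ t in (-1 : ℝ)..1, bergDeriv c 0 t * (1 - t ^ 2) ^ a =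
      2 ^ (2 * a + 1) * Real.Gamma (a + 1) ^ 2 * (2 * a + 1) /
        ((2 * a + 2) * Real.Gamma (2 * a + 2)) := by
  have hw := continuous_one_sub_sq_rpow ha
  have hlog : Continuous fun t : ℝ => (1 - t) * Real.log (1 - t) :=
    Real.continuous_mul_log.comp (continuous_const.sub continuous_id)
  have ha1 : a + 1 ≠ 0 := by positivity
  have hparts := integral_mul_deriv_eq_neg_of_eqOn (a := -1) (b := 1)
    (f := fun t => Real.log (1 - t) + c) (f' := fun t => -1 / (1 - t))
    (u := fun t => -(1 - t ^ 2) ^ (a + 1) / (2 * (a + 1))) (u' := fun t => t * (1 - t ^ 2) ^ a)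
    (G := fun t => -((1 - t) * Real.log (1 - t) + c * (1 - t)) * (1 + t) * (1 - t ^ 2) ^ a /
      (2 * (a + 1))) (by norm_num)
    (fun t ht => by
      have h0 : 1 - t ≠ 0 := by linarith [ht.2]
      have hx : HasDerivAt (fun s : ℝ => 1 - s) (-1) t := by
        simpa using (hasDerivAt_id t).const_sub 1
      exact (hx.log h0).add_const c)
    (fun t ht => by
      have hpos := one_sub_sq_pos_of_mem_Ioo ht
      have hx : HasDerivAt (fun s : ℝ => 1 - s ^ 2) (-(2 * t)) t := by
        simpa using (hasDerivAt_pow 2 t).const_sub 1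
      refine ((hx.rpow_const (p := a + 1) (Or.inl hpos.ne')).neg.div_const
        (2 * (a + 1))).congr_deriv ?_
      rw [add_sub_cancel_right]
      field_simp)
    (Continuous.continuousOn (by fun_prop)) (by simp) (by simp)
    (fun t ht => by
      simp only
      rw [Real.rpow_add_one (one_sub_sq_pos_of_mem_Ioo ht).ne']
      ring)
    (by
      have h := (intervalIntegrable_log_one_sub (-1) 1).add
        (intervalIntegrable_const (c := c) (μ := MeasureTheory.volume) (a := -1) (b := 1))
      exact h.mul_continuousOn (Continuous.continuousOn (by fun_prop)))
    (by
      refine (Continuous.intervalIntegrable (u := fun t : ℝ => (1 + t) * (1 - t ^ 2) ^ a /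
        (2 * (a + 1))) (by fun_prop) _ _).congr_uIoo fun t ht => ?_
      rw [Set.uIoo_of_le (by norm_num)] at ht
      have h0 : 1 - t ≠ 0 := by linarith [ht.2]
      simp only
      rw [Real.rpow_add_one (one_sub_sq_pos_of_mem_Ioo ht).ne']
      field_simp
      ring)
  have hf'u : ∫ t in (-1 : ℝ)..1, -1 / (1 - t) * (-(1 - t ^ 2) ^ (a + 1) / (2 * (a + 1))) =
      1 / (2 * (a + 1)) * ∫ t in (-1 : ℝ)..1, (1 - t) ^ a * (1 + t) ^ (a + 1) := by
    rw [← intervalIntegral.integral_const_mul]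
    refine intervalIntegral.integral_congr_Ioo_of_le (by norm_num) fun t ht => ?_
    have h0 : 1 - t ≠ 0 := by linarith [ht.2]
    have h1 : 1 + t ≠ 0 := by linarith [ht.1]
    rw [one_sub_sq_rpow_eq ht, Real.rpow_add_one h0, Real.rpow_add_one h1]
    field_simp
  rw [hf'u, integral_one_sub_rpow_mul_one_add_rpow ha (by linarith)] at hparts
  have hone : ∫ t in (-1 : ℝ)..1, (1 - t ^ 2) ^ a =
      ∫ t in (-1 : ℝ)..1, (1 - t) ^ a * (1 + t) ^ a :=
    intervalIntegral.integral_congr_Ioo_of_le (by norm_num) fun t ht => one_sub_sq_rpow_eq ht a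
  rw [integral_one_sub_rpow_mul_one_add_rpow ha ha] at hone
  have hsplit : ∫ t in (-1 : ℝ)..1, bergDeriv c 0 t * (1 - t ^ 2) ^ a =
      ∫ t in (-1 : ℝ)..1, ((1 - t ^ 2) ^ a + (Real.log (1 - t) + c) * (t * (1 - t ^ 2) ^ a)) := by
    congr 1; funext t; simp only [bergDeriv]; ring
  rw [hsplit, intervalIntegral.integral_add (hw.intervalIntegrable _ _)
    (((intervalIntegrable_log_one_sub (-1) 1).add intervalIntegrable_const).mul_continuousOn
      (Continuous.continuousOn (by fun_prop))), hone, hparts,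
    show a + a + 1 = 2 * a + 1 by ring, show a + (a + 1) + 1 = 2 * a + 1 + 1 by ring,
    show a + a + 2 = 2 * a + 2 by ring, show a + (a + 1) + 2 = 2 * a + 2 + 1 by ring,
    Real.Gamma_add_one (s := 2 * a + 2) (by positivity), Real.Gamma_add_one (s := a + 1) ha1,
    Real.rpow_add_one (x := 2) (y := 2 * a + 1) (by norm_num)]
  have hG : 0 < Real.Gamma (2 * a + 2) := Real.Gamma_pos_of_pos (by linarith)
  have h2 : 2 * a + 2 ≠ 0 := by positivity
  set r : ℝ := 2 ^ (2 * a + 1)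
  field_simp
  ring

theorem integral_bergG3_mul_legendreP {n : ℕ} (hn : 3 ≤ n) (k : ℕ) :
    ∫ t in (-1 : ℝ)..1, bergG3 t * legendreP n k t * (1 - t ^ 2) ^ (((n : ℝ) - 3) / 2) =
      1 / (2 * Real.pi) / (2 ^ k * (ascPochhammer ℝ k).eval (((n : ℝ) - 1) / 2)) *
        ∫ t in (-1 : ℝ)..1, bergDeriv (4 / 3 - Real.log 2) k t *
          (1 - t ^ 2) ^ (((n : ℝ) - 3) / 2 + k) := by
  have ha : 0 ≤ ((n : ℝ) - 3) / 2 := by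
    have : (3 : ℝ) ≤ n := by exact_mod_cast hn
    linarith
  have h := integral_bergDeriv_mul_iteratedDeriv (4 / 3 - Real.log 2) ha k
  have hsq : ((-1 : ℝ) ^ k) * (-1) ^ k = 1 := by rw [← mul_pow]; simp
  calc _ = ∫ t in (-1 : ℝ)..1,
        ((-1) ^ k * (1 / (2 * Real.pi) / (2 ^ k * (ascPochhammer ℝ k).eval (((n : ℝ) - 1) / 2)))) *
          (bergDeriv (4 / 3 - Real.log 2) 0 t *
            iteratedDeriv k (fun s : ℝ => (1 - s ^ 2) ^ (((n : ℝ) - 3) / 2 + k)) t) := by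
        refine intervalIntegral.integral_congr_Ioo_of_le (by norm_num) fun t ht => ?_
        have hpos := one_sub_sq_pos_of_mem_Ioo ht
        have hne := (Real.rpow_pos_of_pos hpos (((n : ℝ) - 3) / 2)).ne'
        simp only [bergG3, legendreP, bergDeriv]
        rw [Real.rpow_neg hpos.le]
        field_simp
    _ = _ := by
        rw [intervalIntegral.integral_const_mul, h]
        linear_combination (1 / (2 * Real.pi) /
          (2 ^ k * (ascPochhammer ℝ k).eval (((n : ℝ) - 1) / 2)) *
          ∫ t in (-1 : ℝ)..1, bergDeriv (4 / 3 - Real.log 2) k t *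
            (1 - t ^ 2) ^ (((n : ℝ) - 3) / 2 + k)) * hsq

/-- the multipliers of C. Berg's function `g₃`:
`ω_{n−1} ∫_{−1}^{1} g₃(t) P_k^n(t) (1−t²)^{(n−3)/2} dt
  = −(π^{(n−3)/2}/2) Γ((n−1)/2) Γ((k−1)/2) Γ((k+2)/2) / (Γ((n+k−2)/2) Γ((n+k+1)/2))`. -/
theorem berg_g3_multipliers (n : ℕ) (hn : 3 ≤ n) (k : ℕ) (hk : k ≠ 1) :
    omegaBall (n - 1) *
      ∫ t in (-1 : ℝ)..1, bergG3 t * legendreP n k t * (1 - t ^ 2) ^ (((n : ℝ) - 3) / 2)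
    = -(Real.pi ^ (((n : ℝ) - 3) / 2) / 2) * Real.Gamma (((n : ℝ) - 1) / 2) *
        Real.Gamma (((k : ℝ) - 1) / 2) * Real.Gamma (((k : ℝ) + 2) / 2) /
        (Real.Gamma (((n : ℝ) + (k : ℝ) - 2) / 2) * Real.Gamma (((n : ℝ) + (k : ℝ) + 1) / 2)) := by
  have hn3 : (3 : ℝ) ≤ n := by exact_mod_cast hn
  rw [integral_bergG3_mul_legendreP hn, omegaBall, Nat.cast_sub (by omega), Nat.cast_one]
  obtain ⟨a, ha⟩ : ∃ a : ℝ, ((n : ℝ) - 3) / 2 = a := ⟨_, rfl⟩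
  have hna : (n : ℝ) = 2 * a + 3 := by linarith
  have ha0 : 0 ≤ a := by linarith
  have hπ := Real.pi_pos
  have hsπ : 0 < √Real.pi := Real.sqrt_pos.2 hπ
  have hG1 : 0 < Real.Gamma (a + 1) := Real.Gamma_pos_of_pos (by linarith)
  rw [ha, hna, show (2 * a + 3 - 1) / 2 = a + 1 by ring, Real.rpow_add_one hπ.ne']
  match k, hk with
  | 0, _ =>
    have hhalf : Real.Gamma (-1 / 2) = -2 * √Real.pi := by
      have h := Real.Gamma_add_one (s := -1 / 2) (by norm_num)
      rw [show (-1 / 2 + 1 : ℝ) = 1 / 2 by norm_num, Real.Gamma_one_half_eq] at h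
      linarith
    have hG2 : 0 < Real.Gamma (a + 1 / 2) := Real.Gamma_pos_of_pos (by linarith)
    have hdup := Real.Gamma_mul_Gamma_add_half (a + 1 / 2)
    rw [show a + 1 / 2 + 1 / 2 = a + 1 by ring, show 2 * (a + 1 / 2) = 2 * a + 1 by ring,
      show 1 - (2 * a + 1) = -(2 * a) by ring, Real.rpow_neg (by norm_num)] at hdup
    have hG3 : 0 < Real.Gamma (2 * a + 1) := Real.Gamma_pos_of_pos (by linarith)
    have h2a : (0 : ℝ) < 2 ^ (2 * a) := by positivity
    simp only [Nat.cast_zero, add_zero]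
    rw [integral_bergDeriv_zero_mul_one_sub_sq_rpow _ ha0,
      show (2 * a + 3 - 2) / 2 = a + 1 / 2 by ring, show (2 * a + 3 + 1) / 2 = a + 1 + 1 by ring,
      show ((0 : ℝ) - 1) / 2 = -1 / 2 by ring, hhalf, show ((0 : ℝ) + 2) / 2 = 1 by ring,
      Real.Gamma_one, show 2 * a + 2 = 2 * a + 1 + 1 by ring,
      Real.Gamma_add_one (s := 2 * a + 1) (by positivity),
      Real.Gamma_add_one (s := a + 1) (by positivity), Real.rpow_add_one (by norm_num)]
    have hG2' : Real.Gamma (a + 1 / 2) =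
        Real.Gamma (2 * a + 1) * √Real.pi / (2 ^ (2 * a) * Real.Gamma (a + 1)) := by
      field_simp at hdup ⊢
      linarith
    rw [hG2', pow_zero, ascPochhammer_zero, Polynomial.eval_one]
    have h1 : 2 * a + 1 ≠ 0 := by positivity
    have h2 : 2 * a + 1 + 1 ≠ 0 := by positivity
    have h3 : a + 1 ≠ 0 := by positivity
    field_simp
    ring
  | m + 2, _ =>
    have hm : (0 : ℝ) ≤ m := m.cast_nonneg
    rw [integral_bergDeriv_mul_one_sub_sq_rpow _ ha0]
    have hpoch := Real.Gamma_add_nat_eq_ascPochhammer_mul (x := a + 1) (by linarith) (m + 2)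
    rw [show a + 1 + ((m + 2 : ℕ) : ℝ) = a + m + 3 by push_cast; ring] at hpoch
    have hP := ascPochhammer_pos (m + 2) (a + 1) (by linarith)
    have hd1 := Real.Gamma_mul_Gamma_add_half ((m + 1) / 2 : ℝ)
    have hd2 := Real.Gamma_mul_Gamma_add_half (a + (m + 3) / 2 : ℝ)
    rw [show ((m : ℝ) + 1) / 2 + 1 / 2 = (m + 2) / 2 by ring,
      show 2 * (((m : ℝ) + 1) / 2) = m + 1 by ring, Real.Gamma_nat_eq_factorial,
      show 1 - ((m : ℝ) + 1) = -m by ring, Real.rpow_neg (by norm_num), Real.rpow_natCast] at hd1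
    rw [show a + ((m : ℝ) + 3) / 2 + 1 / 2 = a + (m + 4) / 2 by ring,
      show 2 * (a + ((m : ℝ) + 3) / 2) = 2 * a + m + 3 by ring,
      show 1 - (2 * a + (m : ℝ) + 3) = -(2 * a + (m + 2 : ℕ)) by push_cast; ring,
      Real.rpow_neg (by norm_num), Real.rpow_add_natCast (by norm_num)] at hd2
    push_cast
    rw [show ((m : ℝ) + 2 - 1) / 2 = (m + 1) / 2 by ring,
      show ((m : ℝ) + 2 + 2) / 2 = (m + 2) / 2 + 1 by ring,
      show (2 * a + 3 + ((m : ℝ) + 2) - 2) / 2 = a + (m + 3) / 2 by ring,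
      show (2 * a + 3 + ((m : ℝ) + 2) + 1) / 2 = a + (m + 4) / 2 + 1 by ring,
      Real.Gamma_add_one (s := ((m : ℝ) + 2) / 2) (by positivity),
      Real.Gamma_add_one (s := a + ((m : ℝ) + 4) / 2) (by positivity), hpoch,
      show 2 * a + (m : ℝ) + 3 = 2 * a + (m + 2 : ℕ) + 1 by push_cast; ring,
      Real.rpow_add_one (by norm_num), Real.rpow_add_natCast (by norm_num),
      show 2 * a + ((m + 2 : ℕ) : ℝ) + 1 = 2 * a + m + 3 by push_cast; ring]
    have hG3 : 0 < Real.Gamma (2 * a + m + 3) := Real.Gamma_pos_of_pos (by linarith)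
    have hG4 : 0 < Real.Gamma (a + (m + 3) / 2) := Real.Gamma_pos_of_pos (by linarith)
    have hG5 : 0 < Real.Gamma (((m : ℝ) + 1) / 2) := Real.Gamma_pos_of_pos (by linarith)
    have hG4' : Real.Gamma (a + (m + 4) / 2) = Real.Gamma (2 * a + m + 3) *
        (2 ^ (2 * a) * 2 ^ (m + 2))⁻¹ * √Real.pi / Real.Gamma (a + (m + 3) / 2) := by
      rw [eq_div_iff hG4.ne', mul_comm, hd2]
    have hG5' : Real.Gamma (((m : ℝ) + 2) / 2) =
        m.factorial * (2 ^ m)⁻¹ * √Real.pi / Real.Gamma (((m : ℝ) + 1) / 2) := by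
      rw [eq_div_iff hG5.ne', mul_comm, hd1]
    rw [hG4', hG5']
    have h2a : (0 : ℝ) < 2 ^ (2 * a) := by positivity
    have h4 : 2 * a + m + 4 ≠ 0 := by positivity
    have h5 : a + ((m : ℝ) + 4) / 2 ≠ 0 := by positivity
    field_simp
    ring
end

section
/- For every real β > 0, every natural number k ≠ 1 and every natural number l, the function q satisfies 4(2β+k+4)·q(β+1,k,l) − (2β+k+1)·q(β,k,l) = q(β,k,l+1)·C(β,k,l+1) − q(β,k,l)·C(β,k,l), where C(β,k,l) = −l·(k+2l−1)/(β+k+2l). -/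
/-- The Zeilberger summand
`q(β,k,l) = ((2l)!/(2l−1)) (β+k+2l) Γ(β+k+l+1)² /
  ((k+2l−1)(2β+k+2l+1)(β+k+l) Γ(2β+2k+2l+2) (l!)²)`. -/
noncomputable def qZeil (β : ℝ) (k l : ℕ) : ℝ :=
  ((Nat.factorial (2 * l) : ℝ) / (2 * (l : ℝ) - 1)) * (β + (k : ℝ) + 2 * (l : ℝ)) *
    (Real.Gamma (β + (k : ℝ) + (l : ℝ) + 1)) ^ 2 /
    (((k : ℝ) + 2 * (l : ℝ) - 1) * (2 * β + (k : ℝ) + 2 * (l : ℝ) + 1) *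
      (β + (k : ℝ) + (l : ℝ)) * Real.Gamma (2 * β + 2 * (k : ℝ) + 2 * (l : ℝ) + 2) *
      (Nat.factorial l : ℝ) ^ 2)

/-- The certificate `C(β,k,l) = −l(k+2l−1)/(β+k+2l)`. -/
noncomputable def certC (β : ℝ) (k l : ℕ) : ℝ :=
  -((l : ℝ) * ((k : ℝ) + 2 * (l : ℝ) - 1) / (β + (k : ℝ) + 2 * (l : ℝ)))

/-- the first Zeilberger recurrence for `q`:
`4(2β+k+4) q(β+1,k,l) − (2β+k+1) q(β,k,l) = q(β,k,l+1) C(β,k,l+1) − q(β,k,l) C(β,k,l)`. -/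
theorem q_first_recurrence (β : ℝ) (hβ : 0 < β) (k : ℕ) (hk : k ≠ 1) (l : ℕ) :
    4 * (2 * β + (k : ℝ) + 4) * qZeil (β + 1) k l - (2 * β + (k : ℝ) + 1) * qZeil β k l
      = qZeil β k (l + 1) * certC β k (l + 1) - qZeil β k l * certC β k l := by
  have hl : (0 : ℝ) ≤ l := l.cast_nonneg
  have hk0 : (0 : ℝ) ≤ k := k.cast_nonneg
  have h2l : 2 * (l : ℝ) - 1 ≠ 0 := by
    intro h
    have : 2 * l = 1 := by exact_mod_cast sub_eq_zero.mp h
    omega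
  have hkl : (k : ℝ) + 2 * l - 1 ≠ 0 := by
    intro h
    have : k + 2 * l = 1 := by exact_mod_cast sub_eq_zero.mp h
    omega
  have hx : β + k + l + 1 ≠ 0 := by positivity
  have hG : Real.Gamma (β + k + l + 1 + 1) = (β + k + l + 1) * Real.Gamma (β + k + l + 1) :=
    Real.Gamma_add_one hx
  have hH : Real.Gamma (2 * β + 2 * k + 2 * l + 2 + 1 + 1) =
      (2 * β + 2 * k + 2 * l + 2 + 1) * ((2 * β + 2 * k + 2 * l + 2) *
        Real.Gamma (2 * β + 2 * k + 2 * l + 2)) := by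
    rw [Real.Gamma_add_one (by positivity), Real.Gamma_add_one (by positivity)]
  have hH0 : Real.Gamma (2 * β + 2 * k + 2 * l + 2) ≠ 0 :=
    (Real.Gamma_pos_of_pos (by positivity)).ne'
  have hf : (Nat.factorial l : ℝ) ≠ 0 := by positivity
  have hfac : (Nat.factorial (2 * (l + 1)) : ℝ) =
      (2 * l + 2) * ((2 * l + 1) * Nat.factorial (2 * l)) := by
    rw [show 2 * (l + 1) = 2 * l + 1 + 1 by ring, Nat.factorial_succ, Nat.factorial_succ]
    push_cast
    ring
  have hkl1 : (k : ℝ) + 2 * (l + 1) - 1 ≠ 0 := by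
    rw [show (k : ℝ) + 2 * (l + 1) - 1 = k + 2 * l + 1 by ring]
    positivity
  unfold qZeil certC
  rw [hfac, Nat.factorial_succ]
  push_cast
  rw [show β + 1 + (k : ℝ) + l + 1 = β + k + l + 1 + 1 by ring,
    show β + (k : ℝ) + (l + 1) + 1 = β + k + l + 1 + 1 by ring,
    show 2 * (β + 1) + 2 * (k : ℝ) + 2 * l + 2 = 2 * β + 2 * k + 2 * l + 2 + 1 + 1 by ring,
    show 2 * β + 2 * (k : ℝ) + 2 * (l + 1) + 2 = 2 * β + 2 * k + 2 * l + 2 + 1 + 1 by ring,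
    hG, hH]
  generalize Real.Gamma (β + k + l + 1) = G
  generalize Real.Gamma (2 * β + 2 * k + 2 * l + 2) = H at hH0 ⊢
  generalize (Nat.factorial (2 * l) : ℝ) = F
  generalize (Nat.factorial l : ℝ) = f at hf ⊢
  rw [show β + 1 + (k : ℝ) + l = β + k + l + 1 by ring,
    show β + (k : ℝ) + (l + 1) = β + k + l + 1 by ring,
    show 2 * (β + 1) + (k : ℝ) + 2 * l + 1 = 2 * β + k + 2 * l + 3 by ring,
    show 2 * β + (k : ℝ) + 2 * (l + 1) + 1 = 2 * β + k + 2 * l + 3 by ring,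
    show 2 * ((l : ℝ) + 1) - 1 = 2 * l + 1 by ring,
    show 2 * β + 2 * (k : ℝ) + 2 * l + 2 = 2 * (β + k + l + 1) by ring]
  have h1 : 2 * β + (k : ℝ) + 2 * l + 1 ≠ 0 := by positivity
  have h2 : 2 * β + (k : ℝ) + 2 * l + 3 ≠ 0 := by positivity
  have h3 : β + (k : ℝ) + l ≠ 0 := by positivity
  have h4 : β + (k : ℝ) + 2 * l ≠ 0 := by positivity
  have h5 : β + (k : ℝ) + 2 * (l + 1) ≠ 0 := by positivity
  have h6 : 2 * (β + (k : ℝ) + l + 1) + 1 ≠ 0 := by positivity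
  have h7 : 2 * (l : ℝ) + 1 ≠ 0 := by positivity
  have h8 : (l : ℝ) + 1 ≠ 0 := by positivity
  field_simp
  ring
end

section
/- For every real β > 0, every natural number k ≠ 1 and every natural number l, the function q satisfies 16(k+2)(2β+k+4)·q(β,k+2,l) − (k−1)(2β+k+1)·q(β,k,l) = q(β,k,l+1)·F(β,k,l+1) − q(β,k,l)·F(β,k,l), where F(β,k,l) = −(1/((β+k+2l)(2β+2k+2l+3))) · (l·p₁(β,k) + l²·p₂(β,k) + l³·p₃(β,k)) with p₁(β,k) = 8β³ + 16kβ² + 20β² + 12k²β + 26kβ + 10β + 4k³ + 9k² + 4k + 3, p₂(β,k) = 16β² + 24kβ + 32β + 12k² + 24k + 4, and p₃(β,k) = 8β + 8k + 12. -/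
noncomputable def polyP1 (β k : ℝ) : ℝ :=
  8 * β ^ 3 + 16 * k * β ^ 2 + 20 * β ^ 2 + 12 * k ^ 2 * β + 26 * k * β + 10 * β +
    4 * k ^ 3 + 9 * k ^ 2 + 4 * k + 3

noncomputable def polyP2 (β k : ℝ) : ℝ :=
  16 * β ^ 2 + 24 * k * β + 32 * β + 12 * k ^ 2 + 24 * k + 4

noncomputable def polyP3 (β k : ℝ) : ℝ :=
  8 * β + 8 * k + 12

/-- The certificate `F(β,k,l)`. -/
noncomputable def certF (β : ℝ) (k l : ℕ) : ℝ :=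
  -(1 / ((β + (k : ℝ) + 2 * (l : ℝ)) * (2 * β + 2 * (k : ℝ) + 2 * (l : ℝ) + 3))) *
    ((l : ℝ) * polyP1 β (k : ℝ) + (l : ℝ) ^ 2 * polyP2 β (k : ℝ) +
      (l : ℝ) ^ 3 * polyP3 β (k : ℝ))

theorem gamma_add_two {x : ℝ} (hx : 0 < x) :
    Real.Gamma (x + 2) = (x + 1) * x * Real.Gamma x := by
  rw [show x + 2 = x + 1 + 1 by ring, Real.Gamma_add_one (by positivity),
    Real.Gamma_add_one hx.ne']
  ring

/-- the second Zeilberger recurrence for `q`: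
`16(k+2)(2β+k+4) q(β,k+2,l) − (k−1)(2β+k+1) q(β,k,l)
  = q(β,k,l+1) F(β,k,l+1) − q(β,k,l) F(β,k,l)`. -/
theorem q_second_recurrence (β : ℝ) (hβ : 0 < β) (k : ℕ) (hk : k ≠ 1) (l : ℕ) :
    16 * ((k : ℝ) + 2) * (2 * β + (k : ℝ) + 4) * qZeil β (k + 2) l -
        ((k : ℝ) - 1) * (2 * β + (k : ℝ) + 1) * qZeil β k l
      = qZeil β k (l + 1) * certF β k (l + 1) - qZeil β k l * certF β k l := by
  have hkR : (0 : ℝ) ≤ k := k.cast_nonneg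
  have hlR : (0 : ℝ) ≤ l := l.cast_nonneg
  have hodd : 2 * (l : ℝ) - 1 ≠ 0 := by
    have h : (2 * (l : ℤ) - 1) ≠ 0 := by omega
    exact_mod_cast h
  have hkl : (k : ℝ) + 2 * l - 1 ≠ 0 := by
    have h : ((k : ℤ) + 2 * l - 1) ≠ 0 := by omega
    exact_mod_cast h
  have hΓ₁ : Real.Gamma (β + k + l + 1) ≠ 0 := (Real.Gamma_pos_of_pos (by positivity)).ne'
  have hΓ₂ : Real.Gamma (2 * β + 2 * k + 2 * l + 2) ≠ 0 :=
    (Real.Gamma_pos_of_pos (by positivity)).ne'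
  have hfl : (Nat.factorial l : ℝ) ≠ 0 := by positivity
  have hG₁ : Real.Gamma (β + (k + 2 : ℕ) + l + 1) =
      (β + k + l + 2) * (β + k + l + 1) * Real.Gamma (β + k + l + 1) := by
    rw [show β + (k + 2 : ℕ) + l + 1 = β + k + l + 1 + 2 by push_cast; ring,
      gamma_add_two (by positivity)]
    ring
  have hG₂ : Real.Gamma (2 * β + 2 * (k + 2 : ℕ) + 2 * l + 2) =
      (2 * β + 2 * k + 2 * l + 5) * (2 * β + 2 * k + 2 * l + 4) *
        (2 * β + 2 * k + 2 * l + 3) * (2 * β + 2 * k + 2 * l + 2) *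
        Real.Gamma (2 * β + 2 * k + 2 * l + 2) := by
    rw [show 2 * β + 2 * (k + 2 : ℕ) + 2 * l + 2 = 2 * β + 2 * k + 2 * l + 2 + 2 + 2 by
        push_cast; ring, gamma_add_two (by positivity), gamma_add_two (by positivity)]
    ring
  have hG₃ : Real.Gamma (β + k + (l + 1 : ℕ) + 1) =
      (β + k + l + 1) * Real.Gamma (β + k + l + 1) := by
    rw [show β + k + (l + 1 : ℕ) + 1 = β + k + l + 1 + 1 by push_cast; ring,
      Real.Gamma_add_one (by positivity)]
  have hG₄ : Real.Gamma (2 * β + 2 * k + 2 * (l + 1 : ℕ) + 2) =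
      (2 * β + 2 * k + 2 * l + 3) * (2 * β + 2 * k + 2 * l + 2) *
        Real.Gamma (2 * β + 2 * k + 2 * l + 2) := by
    rw [show 2 * β + 2 * k + 2 * (l + 1 : ℕ) + 2 = 2 * β + 2 * k + 2 * l + 2 + 2 by
        push_cast; ring, gamma_add_two (by positivity)]
    ring
  have hfac : (Nat.factorial (2 * (l + 1)) : ℝ) =
      (2 * l + 2) * (2 * l + 1) * Nat.factorial (2 * l) := by
    rw [show 2 * (l + 1) = 2 * l + 1 + 1 by ring, Nat.factorial_succ, Nat.factorial_succ]
    push_cast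
    ring
  simp only [qZeil, certF, polyP1, polyP2, polyP3, hG₁, hG₂, hG₃, hG₄, hfac, Nat.factorial_succ l]
  push_cast
  generalize Real.Gamma (β + k + l + 1) = g at *
  generalize Real.Gamma (2 * β + 2 * k + 2 * l + 2) = g' at *
  generalize (Nat.factorial l : ℝ) = f at *
  generalize (Nat.factorial (2 * l) : ℝ) = f' at *
  clear hG₁ hG₂ hG₃ hG₄ hfac hk
  generalize (k : ℝ) = x at *
  generalize (l : ℝ) = y at *
  rw [show x + 2 + 2 * y - 1 = x + 2 * y + 1 by ring,
    show x + 2 * (y + 1) - 1 = x + 2 * y + 1 by ring,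
    show 2 * (y + 1) - 1 = 2 * y + 1 by ring]
  field_simp
  ring
end

section
/- For every real β > 0 and every natural number k ≠ 1, the series Σ_{l=0}^{∞} q(β,k,l) converges absolutely; writing Q(β,k) for its sum, one has Q(β,k+2) = ((k−1)(2β+k+1))/(16(k+2)(2β+k+4)) · Q(β,k). -/
open Filter Topology

/-- The factor of `qZeil β k l` that is not rational in `l`. -/
noncomputable def gammaFactor (β : ℝ) (k l : ℕ) : ℝ :=
  (Nat.factorial (2 * l) : ℝ) * Real.Gamma (β + k + l + 1) ^ 2 /
    (Real.Gamma (2 * β + 2 * k + 2 * l + 2) * (Nat.factorial l : ℝ) ^ 2)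

theorem qZeil_eq (β : ℝ) (k l : ℕ) :
    qZeil β k l = (β + k + 2 * l) /
      ((2 * l - 1) * (k + 2 * l - 1) * (2 * β + k + 2 * l + 1) * (β + k + l)) *
        gammaFactor β k l := by
  simp only [qZeil, gammaFactor, div_eq_mul_inv, mul_inv]
  ring

theorem gammaFactor_nonneg {β : ℝ} (hβ : 0 < β) (k l : ℕ) : 0 ≤ gammaFactor β k l := by
  have h : 0 < Real.Gamma (2 * β + 2 * k + 2 * l + 2) := Real.Gamma_pos_of_pos (by positivity)
  unfold gammaFactor
  positivity

theorem gammaFactor_succ {β : ℝ} (hβ : 0 < β) (k l : ℕ) :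
    gammaFactor β k (l + 1) =
      (2 * l + 1) * (β + k + l + 1) / ((l + 1) * (2 * β + 2 * k + 2 * l + 3)) *
        gammaFactor β k l := by
  have hx : β + k + l + 1 ≠ 0 := by positivity
  have hy : 2 * β + 2 * k + 2 * l + 2 ≠ 0 := by positivity
  have hz : 2 * β + 2 * k + 2 * l + 3 ≠ 0 := by positivity
  have h : Real.Gamma (2 * β + 2 * k + 2 * l + 2) ≠ 0 :=
    (Real.Gamma_pos_of_pos (by positivity)).ne'
  have e₁ : Real.Gamma (β + k + (l + 1 : ℕ) + 1) =
      (β + k + l + 1) * Real.Gamma (β + k + l + 1) := by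
    rw [← Real.Gamma_add_one hx]; push_cast; ring_nf
  have e₂ : Real.Gamma (2 * β + 2 * k + 2 * (l + 1 : ℕ) + 2) =
      (2 * β + 2 * k + 2 * l + 3) * ((2 * β + 2 * k + 2 * l + 2) *
        Real.Gamma (2 * β + 2 * k + 2 * l + 2)) := by
    rw [← Real.Gamma_add_one hy,
      show 2 * β + 2 * k + 2 * l + 3 = 2 * β + 2 * k + 2 * l + 2 + 1 by ring,
      ← Real.Gamma_add_one (by positivity)]
    push_cast; ring_nf
  have hl : (Nat.factorial l : ℝ) ≠ 0 := by positivity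
  rw [gammaFactor, gammaFactor, e₁, e₂, show 2 * (l + 1) = 2 * l + 1 + 1 by ring,
    Nat.factorial_succ, Nat.factorial_succ, Nat.factorial_succ]
  push_cast
  field_simp
  ring

theorem gammaFactor_add_two {β : ℝ} (hβ : 0 < β) (k l : ℕ) :
    gammaFactor β (k + 2) l =
      (β + k + l + 1) * (β + k + l + 2) /
        (4 * (2 * β + 2 * k + 2 * l + 3) * (2 * β + 2 * k + 2 * l + 5)) *
        gammaFactor β k l := by
  have hx : β + k + l + 1 ≠ 0 := by positivity
  have hx' : β + k + l + 2 ≠ 0 := by positivity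
  have hy : 2 * β + 2 * k + 2 * l + 2 ≠ 0 := by positivity
  have hz : 2 * β + 2 * k + 2 * l + 3 ≠ 0 := by positivity
  have hw : 2 * β + 2 * k + 2 * l + 5 ≠ 0 := by positivity
  have h : Real.Gamma (2 * β + 2 * k + 2 * l + 2) ≠ 0 :=
    (Real.Gamma_pos_of_pos (by positivity)).ne'
  have e₁ : Real.Gamma (β + (k + 2 : ℕ) + l + 1) =
      (β + k + l + 2) * ((β + k + l + 1) * Real.Gamma (β + k + l + 1)) := by
    rw [← Real.Gamma_add_one hx, show β + k + l + 2 = β + k + l + 1 + 1 by ring,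
      ← Real.Gamma_add_one (by positivity)]
    push_cast; ring_nf
  have e₂ : Real.Gamma (2 * β + 2 * (k + 2 : ℕ) + 2 * l + 2) =
      (2 * β + 2 * k + 2 * l + 5) * (2 * (β + k + l + 2) *
        ((2 * β + 2 * k + 2 * l + 3) * (2 * (β + k + l + 1) *
        Real.Gamma (2 * β + 2 * k + 2 * l + 2)))) := by
    rw [show 2 * (β + k + l + 1) = 2 * β + 2 * k + 2 * l + 2 by ring, ← Real.Gamma_add_one hy,
      show 2 * β + 2 * k + 2 * l + 3 = 2 * β + 2 * k + 2 * l + 2 + 1 by ring,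
      ← Real.Gamma_add_one (by positivity),
      show 2 * (β + k + l + 2) = 2 * β + 2 * k + 2 * l + 2 + 1 + 1 by ring,
      ← Real.Gamma_add_one (by positivity),
      show 2 * β + 2 * k + 2 * l + 5 = 2 * β + 2 * k + 2 * l + 2 + 1 + 1 + 1 by ring,
      ← Real.Gamma_add_one (by positivity)]
    push_cast; ring_nf
  rw [gammaFactor, gammaFactor, e₁, e₂]
  field_simp
  ring

theorem gammaFactor_le {β : ℝ} (hβ : 0 < β) (k l : ℕ) :
    gammaFactor β k l ≤ gammaFactor β k 0 := by
  refine antitone_nat_of_succ_le (f := gammaFactor β k) (fun n => ?_) (Nat.zero_le l)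
  rw [gammaFactor_succ hβ]
  refine mul_le_of_le_one_left (gammaFactor_nonneg hβ k n) ?_
  rw [div_le_one (by positivity)]
  have : 0 ≤ (k : ℝ) := by positivity
  have : 0 ≤ (n : ℝ) := by positivity
  nlinarith

theorem abs_qZeil_le {β : ℝ} (hβ : 0 < β) (k : ℕ) {l : ℕ} (hl : 1 ≤ l) :
    |qZeil β k l| ≤ 2 * gammaFactor β k 0 / (l : ℝ) ^ 3 := by
  have hl' : (1 : ℝ) ≤ l := by exact_mod_cast hl
  have hk : (0 : ℝ) ≤ k := by positivity
  have h₁ : (l : ℝ) ≤ 2 * l - 1 := by linarith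
  have h₂ : (l : ℝ) ≤ k + 2 * l - 1 := by linarith
  have h₃ : (l : ℝ) ≤ 2 * β + k + 2 * l + 1 := by linarith
  have h₄ : 0 < β + k + l := by linarith
  have hpos : 0 < (2 * l - 1) * (k + 2 * l - 1) * (2 * β + k + 2 * l + 1) :=
    mul_pos (mul_pos (by linarith) (by linarith)) (by linarith)
  have hcube : (l : ℝ) ^ 3 ≤ (2 * l - 1) * (k + 2 * l - 1) * (2 * β + k + 2 * l + 1) := by
    calc (l : ℝ) ^ 3 = l * l * l := by ring
      _ ≤ _ := by gcongr <;> nlinarith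
  have hu := gammaFactor_nonneg hβ k l
  have hnum : 0 ≤ β + k + 2 * l := by linarith
  rw [qZeil_eq, abs_of_nonneg (mul_nonneg (div_nonneg hnum (mul_pos hpos h₄).le) hu)]
  have hrat : (β + k + 2 * l) /
      ((2 * l - 1) * (k + 2 * l - 1) * (2 * β + k + 2 * l + 1) * (β + k + l)) ≤
        2 / (l : ℝ) ^ 3 := by
    rw [div_le_div_iff₀ (mul_pos hpos h₄) (by positivity)]
    calc (β + k + 2 * l) * (l : ℝ) ^ 3
        ≤ (2 * (β + k + l)) *
          ((2 * l - 1) * (k + 2 * l - 1) * (2 * β + k + 2 * l + 1)) := by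
          gcongr
          linarith
      _ = _ := by ring
  calc _ ≤ 2 / (l : ℝ) ^ 3 * gammaFactor β k 0 :=
        mul_le_mul hrat (gammaFactor_le hβ k l) hu (by positivity)
    _ = _ := by ring

theorem summable_abs_qZeil {β : ℝ} (hβ : 0 < β) (k : ℕ) :
    Summable (fun l : ℕ => |qZeil β k l|) := by
  rw [← summable_nat_add_iff 1]
  have h : Summable (fun l : ℕ => 2 * gammaFactor β k 0 / ((l + 1 : ℕ) : ℝ) ^ 3) := by
    simp only [div_eq_mul_inv]
    exact ((summable_nat_add_iff 1).2
      (Real.summable_nat_pow_inv.2 (by norm_num : 1 < 3))).mul_left _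
  exact h.of_nonneg_of_le (fun _ => abs_nonneg _) fun l => abs_qZeil_le hβ k (by lia)

/-- The Wilf–Zeilberger certificate polynomial for the recurrence of `qZeil` in `k`. -/
noncomputable def certPoly (β k l : ℝ) : ℝ :=
  (3 + 4 * k + 9 * k ^ 2 + 4 * k ^ 3 + 10 * β + 26 * β * k + 12 * β * k ^ 2 + 20 * β ^ 2
      + 16 * β ^ 2 * k + 8 * β ^ 3)
    + (4 + 24 * k + 12 * k ^ 2 + 32 * β + 24 * β * k + 16 * β ^ 2) * l
    + (12 + 8 * k + 8 * β) * l ^ 2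

/-- The telescoping antidifference for the recurrence of `qZeil` in `k`. -/
noncomputable def qAntidiff (β : ℝ) (k l : ℕ) : ℝ :=
  -(l * certPoly β k l) / (16 * (k + 2) * (2 * β + k + 4) *
    ((β + k + 2 * l) * (2 * β + 2 * k + 2 * l + 3))) * qZeil β k l

theorem qAntidiff_succ_sub {β : ℝ} (hβ : 0 < β) {k : ℕ} (hk : k ≠ 1) (l : ℕ) :
    qAntidiff β k (l + 1) - qAntidiff β k l =
      qZeil β (k + 2) l - (((k : ℝ) - 1) * (2 * β + k + 1)) /
        (16 * ((k : ℝ) + 2) * (2 * β + k + 4)) * qZeil β k l := by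
  have h₁ : (2 * l - 1 : ℝ) ≠ 0 := by
    intro h
    have : (2 * l : ℝ) = 1 := by linarith
    norm_cast at this
    lia
  have h₂ : (k + 2 * l - 1 : ℝ) ≠ 0 := by
    intro h
    have : (k + 2 * l : ℝ) = 1 := by linarith
    norm_cast at this
    lia
  rw [qAntidiff, qAntidiff, qZeil_eq, qZeil_eq, qZeil_eq, gammaFactor_succ hβ,
    gammaFactor_add_two hβ]
  generalize gammaFactor β k l = u
  unfold certPoly
  push_cast
  have hk0 : (0 : ℝ) ≤ k := by positivity
  have hl0 : (0 : ℝ) ≤ l := by positivity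
  generalize (k : ℝ) = k at *
  generalize (l : ℝ) = l at *
  rw [show 2 * (l + 1) - 1 = 2 * l + 1 by ring, show k + 2 * (l + 1) - 1 = k + 2 * l + 1 by ring,
    show 2 * β + k + 2 * (l + 1) + 1 = 2 * β + k + 2 * l + 3 by ring,
    show β + k + (l + 1) = β + k + l + 1 by ring,
    show β + k + 2 * (l + 1) = β + k + 2 * l + 2 by ring,
    show 2 * β + 2 * k + 2 * (l + 1) + 3 = 2 * β + 2 * k + 2 * l + 5 by ring,
    show k + 2 + 2 * l - 1 = k + 2 * l + 1 by ring,
    show 2 * β + (k + 2) + 2 * l + 1 = 2 * β + k + 2 * l + 3 by ring,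
    show β + (k + 2) + l = β + k + l + 2 by ring,
    show β + (k + 2) + 2 * l = β + k + 2 * l + 2 by ring]
  have a₁ : 2 * l + 1 ≠ 0 := by positivity
  have a₂ : k + 2 * l + 1 ≠ 0 := by positivity
  have a₃ : 2 * β + k + 2 * l + 3 ≠ 0 := by positivity
  have a₄ : β + k + l + 1 ≠ 0 := by positivity
  have a₅ : β + k + 2 * l + 2 ≠ 0 := by positivity
  have a₆ : 2 * β + 2 * k + 2 * l + 5 ≠ 0 := by positivity
  have a₇ : β + k + l + 2 ≠ 0 := by positivity
  have a₈ : β + k + l ≠ 0 := by positivity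
  have a₉ : β + k + 2 * l ≠ 0 := by positivity
  have b₁ : 2 * β + 2 * k + 2 * l + 3 ≠ 0 := by positivity
  have b₂ : 2 * β + k + 2 * l + 1 ≠ 0 := by positivity
  have b₃ : l + 1 ≠ 0 := by positivity
  have b₄ : k + 2 ≠ 0 := by positivity
  have b₅ : 2 * β + k + 4 ≠ 0 := by positivity
  generalize hA : 2 * l - 1 = A at *
  generalize hB : k + 2 * l - 1 = B at *
  field_simp
  rw [← hA, ← hB]
  ring

theorem tendsto_qAntidiff {β : ℝ} (hβ : 0 < β) (k : ℕ) :
    Tendsto (qAntidiff β k) atTop (𝓝 0) := by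
  have hC : 0 ≤ certPoly β k 1 := by unfold certPoly; positivity
  have hlim : Tendsto (fun l : ℕ => certPoly β k 1 * (2 * gammaFactor β k 0) / (l : ℝ) ^ 2)
      atTop (𝓝 0) :=
    tendsto_const_nhds.div_atTop
      ((tendsto_pow_atTop two_ne_zero).comp tendsto_natCast_atTop_atTop)
  refine squeeze_zero_norm' ?_ hlim
  filter_upwards [eventually_ge_atTop 1] with l hl
  have hl' : (1 : ℝ) ≤ l := by exact_mod_cast hl
  have hk : (0 : ℝ) ≤ k := by positivity
  have hP0 : 0 ≤ certPoly β k l := by unfold certPoly; positivity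
  have hP : certPoly β k l ≤ certPoly β k 1 * (l : ℝ) ^ 2 := by
    have h1 : (1 : ℝ) ≤ (l : ℝ) ^ 2 := one_le_pow₀ hl'
    have h2 : (l : ℝ) ≤ (l : ℝ) ^ 2 := le_self_pow₀ hl' two_ne_zero
    have key (a b c : ℝ) (ha : 0 ≤ a) (hb : 0 ≤ b) :
        a + b * l + c * (l : ℝ) ^ 2 ≤ (a + b * 1 + c * 1 ^ 2) * (l : ℝ) ^ 2 := by
      linarith [mul_le_mul_of_nonneg_left h1 ha, mul_le_mul_of_nonneg_left h2 hb]
    exact key _ _ _ (by positivity) (by positivity)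
  have hden : (l : ℝ) ^ 2 ≤ 16 * (k + 2) * (2 * β + k + 4) *
      ((β + k + 2 * l) * (2 * β + 2 * k + 2 * l + 3)) := by
    have h1 : 1 ≤ 16 * (k + 2) * (2 * β + k + 4) := by nlinarith
    have h2 : (l : ℝ) ^ 2 ≤ (β + k + 2 * l) * (2 * β + 2 * k + 2 * l + 3) := by
      rw [sq]; gcongr <;> linarith
    nlinarith
  have hl2 : 0 < (l : ℝ) ^ 2 := by positivity
  rw [qAntidiff, Real.norm_eq_abs, abs_mul, abs_div, abs_neg,
    abs_of_nonneg (mul_nonneg (by positivity) hP0), abs_of_pos (hl2.trans_le hden)]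
  calc _ ≤ (l * (certPoly β k 1 * (l : ℝ) ^ 2)) / (l : ℝ) ^ 2 *
        (2 * gammaFactor β k 0 / (l : ℝ) ^ 3) := by
        gcongr
        exact abs_qZeil_le hβ k hl
    _ = _ := by field_simp

/-- `Σ_l q(β,k,l)` converges absolutely, and writing `Q(β,k)` for its sum,
`Q(β,k+2) = ((k−1)(2β+k+1))/(16(k+2)(2β+k+4)) Q(β,k)`. -/
theorem q_sum_recurrence_k (β : ℝ) (hβ : 0 < β) (k : ℕ) (hk : k ≠ 1) :
    Summable (fun l : ℕ => |qZeil β k l|) ∧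
    (∑' l : ℕ, qZeil β (k + 2) l)
      = (((k : ℝ) - 1) * (2 * β + (k : ℝ) + 1)) /
          (16 * ((k : ℝ) + 2) * (2 * β + (k : ℝ) + 4)) * ∑' l : ℕ, qZeil β k l := by
  refine ⟨summable_abs_qZeil hβ k, ?_⟩
  have h₀ : Summable (qZeil β k) := (summable_abs_qZeil hβ k).of_abs
  have h₂ : Summable (qZeil β (k + 2)) := (summable_abs_qZeil hβ (k + 2)).of_abs
  have hsum := (h₂.hasSum.sub (h₀.hasSum.mul_left
    ((((k : ℝ) - 1) * (2 * β + k + 1)) / (16 * ((k : ℝ) + 2) * (2 * β + k + 4))))).tendsto_sum_nat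
  simp only [← qAntidiff_succ_sub hβ hk, Finset.sum_range_sub] at hsum
  have hzero : qAntidiff β k 0 = 0 := by simp [qAntidiff]
  rw [hzero] at hsum
  simp only [sub_zero] at hsum
  exact sub_eq_zero.1 (tendsto_nhds_unique hsum (tendsto_qAntidiff hβ k))
end
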